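/- Let g ⊊ so(V) be a proper Lie subalgebra acting irreducibly on V. Then exactly one of the following holds: (i) the skew-symmetric prolongation Λ³V ∩ (Λ¹V⊗g) equals {0}; or (ii) there is a Lie bracket [·,·] on V making V a simple real Lie algebra with negative-definite Killing form, the inner product is ad-invariant (⟨[X,Y],Z⟩ is alternating in X,Y,Z), g = {ad_X : X ∈ V}, and the skew-symmetric prolongation is one-dimensional, spanned by the Cartan 3-form T(X,Y,Z) = ⟨[X,Y],Z⟩. -/

import Mathlib

open scoped RealInnerProductSpace BigOperators

noncomputable section

variable {V : Type} [NormedAddCommGroup V] [InnerProductSpace ℝ V] [FiniteDimensional ℝ V]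

/-- A skew-symmetric endomorphism of a real inner product space. -/
def IsSkew (A : V →ₗ[ℝ] V) : Prop := ∀ x y : V, ⟪A x, y⟫ = - ⟪x, A y⟫

/-- `T` lies in the skew-symmetric prolongation `Λ³V ∩ (Λ¹V ⊗ g)`,
i.e. each contraction `T_X` (the skew endomorphism with `⟪T_X Y, Z⟫ = T(X,Y,Z)`)
belongs to `g`. -/
def InProlong (g : Submodule ℝ (V →ₗ[ℝ] V)) (T : AlternatingMap ℝ V ℝ (Fin 3)) : Prop :=
  ∀ X : V, ∃ A ∈ g, ∀ Y Z : V, ⟪A Y, Z⟫ = T ![X, Y, Z]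

/-- Curvature-free reformulation of the prolongation: bilinear products with values in `g`. -/
def InP (g : Submodule ℝ (V →ₗ[ℝ] V)) (τ : V →ₗ[ℝ] V →ₗ[ℝ] V) : Prop :=
  (∀ x, τ x ∈ g) ∧ ∀ x, τ x x = 0

structure Ctx (g : Submodule ℝ (V →ₗ[ℝ] V)) : Prop where
  skew : ∀ A ∈ g, IsSkew A
  lie : ∀ A ∈ g, ∀ B ∈ g, A ∘ₗ B - B ∘ₗ A ∈ g

theorem InP.anti {g : Submodule ℝ (V →ₗ[ℝ] V)} {τ : V →ₗ[ℝ] V →ₗ[ℝ] V} (h : InP g τ) (u v : V) :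
    τ u v = - τ v u := by
  have h1 := h.2 (u + v)
  simp only [map_add, LinearMap.add_apply, h.2, zero_add, add_zero] at h1
  exact eq_neg_of_add_eq_zero_right h1

/-- `a ∧ b` as an endomorphism. -/
def w2 (a b : V) : V →ₗ[ℝ] V :=
  (innerₗ V a).smulRight b - (innerₗ V b).smulRight a

theorem w2_apply (a b u : V) : w2 a b u = ⟪a, u⟫ • b - ⟪b, u⟫ • a := by
  simp [w2]

theorem w2_skew (a b : V) : IsSkew (w2 a b) := by
  intro u v
  simp only [w2_apply, inner_sub_left, inner_sub_right, inner_smul_left, inner_smul_right]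
  simp [real_inner_comm]
  ring

theorem br_w2 {A : V →ₗ[ℝ] V} (hA : IsSkew A) (a b : V) :
    A ∘ₗ w2 a b - w2 a b ∘ₗ A = w2 (A a) b + w2 a (A b) := by
  ext u
  have h1 : ⟪a, A u⟫ = - ⟪A a, u⟫ := by rw [hA a u]; ring
  have h2 : ⟪b, A u⟫ = - ⟪A b, u⟫ := by rw [hA b u]; ring
  simp only [LinearMap.sub_apply, LinearMap.comp_apply, LinearMap.add_apply, w2_apply, map_sub,
    map_smul, h1, h2]
  module

structure Tri (g : Submodule ℝ (V →ₗ[ℝ] V)) (T : V →ₗ[ℝ] V →ₗ[ℝ] V) (x y z : V) : Prop where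
  mem : InP g T
  nx : ⟪x, x⟫ = 1
  ny : ⟪y, y⟫ = 1
  nz : ⟪z, z⟫ = 1
  xy : ⟪x, y⟫ = 0
  yz : ⟪y, z⟫ = 0
  zx : ⟪z, x⟫ = 0
  Txy : T x y = z
  Tyz : T y z = x
  Tzx : T z x = y
  ix : ∀ u v, T x (T u v) = T (T x u) v + T u (T x v)
  iy : ∀ u v, T y (T u v) = T (T y u) v + T u (T y v)
  iz : ∀ u v, T z (T u v) = T (T z u) v + T u (T z v)
  kill : ∀ C ∈ g, C x = 0 → C y = 0 → C z = 0 → ∀ u v, C (T u v) = T (C u) v + T u (C v)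
  bd : ∀ u v, ⟪T u v, T u v⟫ ≤ ⟪u, u⟫ * ⟪v, v⟫

theorem Tri.cyc {g : Submodule ℝ (V →ₗ[ℝ] V)} {T : V →ₗ[ℝ] V →ₗ[ℝ] V} {x y z : V}
    (h : Tri g T x y z) : Tri g T y z x :=
  ⟨h.mem, h.ny, h.nz, h.nx, h.yz, h.zx, h.xy, h.Tyz, h.Tzx, h.Txy, h.iy, h.iz, h.ix,
    fun C hC a b c => h.kill C hC c a b, h.bd⟩

/-- `u` is orthogonal to the triple. -/
def Perp (x y z u : V) : Prop := ⟪x, u⟫ = 0 ∧ ⟪y, u⟫ = 0 ∧ ⟪z, u⟫ = 0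

theorem Perp.cyc {x y z u : V} (h : Perp x y z u) : Perp y z x u := ⟨h.2.1, h.2.2, h.1⟩

theorem Perp.add {x y z u v : V} (h : Perp x y z u) (h' : Perp x y z v) : Perp x y z (u + v) := by
  obtain ⟨a, b, c⟩ := h; obtain ⟨a', b', c'⟩ := h'
  simp [Perp, inner_add_right, *]

theorem Perp.sub {x y z u v : V} (h : Perp x y z u) (h' : Perp x y z v) : Perp x y z (u - v) := by
  obtain ⟨a, b, c⟩ := h; obtain ⟨a', b', c'⟩ := h'
  simp [Perp, inner_sub_right, *]

theorem Perp.smul {x y z u : V} (h : Perp x y z u) (r : ℝ) : Perp x y z (r • u) := by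
  obtain ⟨a, b, c⟩ := h
  simp [Perp, inner_smul_right, *]

theorem poly_aux (c2 c3 c4 : ℝ) (h : ∀ e : ℝ, c2 * e^2 + c3 * e^3 + c4 * e^4 ≤ 0) : c2 ≤ 0 := by
  by_contra hc
  push Not at hc
  set m := |c3| + |c4| + c2 with hm
  have hm0 : 0 < m := by positivity
  have h1 := h (c2 / (2 * m))
  set e := c2 / (2 * m) with he
  have he0 : 0 < e := by positivity
  have he1 : e ≤ 1 := by
    rw [he, div_le_one (by positivity)]
    have := abs_nonneg c3; have := abs_nonneg c4; linarith
  have hem : e * m = c2 / 2 := by rw [he]; field_simp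
  have h2 : c2 + c3 * e + c4 * e^2 ≤ 0 := by
    by_contra h3
    push Not at h3
    have : 0 < e^2 * (c2 + c3 * e + c4 * e^2) := by positivity
    nlinarith
  have h3 : -|c3| * e ≤ c3 * e := by
    have := neg_abs_le c3; nlinarith
  have h4 : -|c4| * e ≤ c4 * e^2 := by
    have := neg_abs_le c4
    have h5 := abs_nonneg c4
    have : -|c4| * e^2 ≤ c4 * e^2 := by nlinarith [sq_nonneg e]
    nlinarith [mul_nonneg h5 (mul_nonneg he0.le (sub_nonneg.2 he1))]
  nlinarith

section TriLemmas
variable {g : Submodule ℝ (V →ₗ[ℝ] V)} {T : V →ₗ[ℝ] V →ₗ[ℝ] V} {x y z : V}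

theorem Tri.sk (h : Tri g T x y z) (hc : Ctx g) (u v w : V) : ⟪T u v, w⟫ = - ⟪v, T u w⟫ :=
  hc.skew _ (h.mem.1 u) v w

theorem Tri.Tyx (h : Tri g T x y z) : T y x = -z := by rw [h.mem.anti, h.Txy]
theorem Tri.Txz (h : Tri g T x y z) : T x z = -y := by rw [h.mem.anti, h.Tzx]
theorem Tri.Tzy (h : Tri g T x y z) : T z y = -x := by rw [h.mem.anti, h.Tyz]

theorem Tri.perpz (h : Tri g T x y z) (hc : Ctx g) {u : V} (hu : Perp x y z u) :
    Perp x y z (T z u) := by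
  obtain ⟨a, b, c⟩ := hu
  refine ⟨?_, ?_, ?_⟩
  · have := h.sk hc z x u; rw [h.Tzx, b] at this; linarith
  · have := h.sk hc z y u; rw [h.Tzy, inner_neg_left, a] at this; linarith
  · have := h.sk hc z z u; rw [h.mem.2, inner_zero_left] at this; linarith

theorem Tri.perpx (h : Tri g T x y z) (hc : Ctx g) {u : V} (hu : Perp x y z u) :
    Perp x y z (T x u) := (h.cyc.perpz hc hu.cyc).cyc.cyc

theorem Tri.perpy (h : Tri g T x y z) (hc : Ctx g) {u : V} (hu : Perp x y z u) :
    Perp x y z (T y u) := (h.cyc.cyc.perpz hc hu.cyc.cyc).cyc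

theorem Tri.zxc (h : Tri g T x y z) (v : V) : T z (T x v) = T y v + T x (T z v) := by
  rw [h.iz, h.Tzx]
theorem Tri.zyc (h : Tri g T x y z) (v : V) : T z (T y v) = - T x v + T y (T z v) := by
  rw [h.iz, h.Tzy]; simp
theorem Tri.xyc (h : Tri g T x y z) (v : V) : T x (T y v) = T z v + T y (T x v) := by
  rw [h.ix, h.Txy]

theorem Tri.var2 (h : Tri g T x y z) (hc : Ctx g) {a b : V} (ha : Perp x y z a)
    (hb : Perp x y z b) :
    2 * ⟪T z a, b⟫ + ⟪T x b - T y a, T x b - T y a⟫ ≤ ⟪a, a⟫ + ⟪b, b⟫ := by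
  have hq1 := (h.perpx hc hb)
  have hq2 := (h.perpy hc ha)
  set q := T x b - T y a with hq
  have hzq : ⟪z, q⟫ = 0 := by rw [hq, inner_sub_right, hq1.2.2, hq2.2.2]; ring
  have hzab : ⟪z, T a b⟫ = ⟪T z a, b⟫ := by
    have h1 := h.sk hc a b z
    rw [h.mem.anti a z, inner_neg_right, real_inner_comm] at h1
    rw [h1, real_inner_comm]; ring
  suffices h0 : ∀ e : ℝ, (2 * ⟪T z a, b⟫ + ⟪q, q⟫ - (⟪a, a⟫ + ⟪b, b⟫)) * e^2
      + (2 * ⟪q, T a b⟫) * e^3 + (⟪T a b, T a b⟫ - ⟪a, a⟫ * ⟪b, b⟫) * e^4 ≤ 0 by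
    have := poly_aux _ _ _ h0
    linarith
  intro e
  have hb1 := h.bd (x + e • a) (y + e • b)
  have hT : T (x + e • a) (y + e • b) = z + e • q + e^2 • T a b := by
    rw [hq]
    simp only [map_add, map_smul, LinearMap.add_apply, LinearMap.smul_apply, h.Txy,
      h.mem.anti a y]
    module
  rw [hT] at hb1
  have e1 : ⟪z + e • q + e^2 • T a b, z + e • q + e^2 • T a b⟫ =
      1 + e^2 * (2 * ⟪T z a, b⟫ + ⟪q, q⟫) + 2 * e^3 * ⟪q, T a b⟫ + e^4 * ⟪T a b, T a b⟫ := by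
    simp only [inner_add_left, inner_add_right, real_inner_smul_left, real_inner_smul_right,
      h.nz, hzq, real_inner_comm z, real_inner_comm q (T a b), hzab]
    ring
  have e2 : ⟪x + e • a, x + e • a⟫ = 1 + e^2 * ⟪a, a⟫ := by
    simp only [inner_add_left, inner_add_right, real_inner_smul_left, real_inner_smul_right, h.nx]
    rw [real_inner_comm x a, ha.1]; ring
  have e3 : ⟪y + e • b, y + e • b⟫ = 1 + e^2 * ⟪b, b⟫ := by
    simp only [inner_add_left, inner_add_right, real_inner_smul_left, real_inner_smul_right, h.ny]
    rw [real_inner_comm y b, hb.2.1]; ring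
  rw [e1, e2, e3] at hb1
  nlinarith

end TriLemmas

section Spin
variable {g : Submodule ℝ (V →ₗ[ℝ] V)} {T : V →ₗ[ℝ] V →ₗ[ℝ] V} {x y z : V}

theorem Tri.eig_vanish (h : Tri g T x y z) {u v : V} {r : ℝ} (hr : 1 < r ^ 2)
    (h1 : T z u = -(r • v)) (h2 : T z v = r • u) : u = 0 ∧ v = 0 := by
  have a1 := h.bd z u
  have a2 := h.bd z v
  rw [h.nz, h1, inner_neg_neg, real_inner_smul_left, real_inner_smul_right] at a1
  rw [h.nz, h2, real_inner_smul_left, real_inner_smul_right] at a2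
  have b1 : (0:ℝ) ≤ ⟪u, u⟫ := real_inner_self_nonneg
  have b2 : (0:ℝ) ≤ ⟪v, v⟫ := real_inner_self_nonneg
  have c1 : ⟪u, u⟫ = 0 := by nlinarith
  have c2 : ⟪v, v⟫ = 0 := by nlinarith
  exact ⟨inner_self_eq_zero.1 c1, inner_self_eq_zero.1 c2⟩

theorem Tri.up1 (h : Tri g T x y z) {a : V} {s : ℝ} (ha : T z (T z a) = -(s ^ 2 • a)) :
    T z (T x (T z a) + s • T y a) = -((1 + s) • (s • T x a - T y (T z a))) := by
  simp only [map_add, map_smul, h.zxc, h.zyc, ha, map_neg]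
  module

theorem Tri.up2 (h : Tri g T x y z) {a : V} {s : ℝ} (ha : T z (T z a) = -(s ^ 2 • a)) :
    T z (s • T x a - T y (T z a)) = (1 + s) • (T x (T z a) + s • T y a) := by
  simp only [map_sub, map_smul, h.zxc, h.zyc, ha, map_neg]
  module

theorem Tri.raise (h : Tri g T x y z) {a : V} {s : ℝ} (hs : 0 < s)
    (ha : T z (T z a) = -(s ^ 2 • a)) :
    T x (T z a) = -(s • T y a) ∧ T y (T z a) = s • T x a := by
  obtain ⟨e1, e2⟩ := h.eig_vanish (r := 1 + s) (by nlinarith) (h.up1 ha) (h.up2 ha)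
  exact ⟨eq_neg_of_add_eq_zero_left e1, (sub_eq_zero.1 e2).symm⟩

theorem Tri.half_bound (h : Tri g T x y z) (hc : Ctx g) {a : V} (hp : Perp x y z a) {s : ℝ}
    (hs : 0 < s) (ha : T z (T z a) = -(s ^ 2 • a)) (h0 : a ≠ 0) : s ≤ 1 / 2 := by
  obtain ⟨e1, e2⟩ := h.raise hs ha
  have hd := h.perpz hc hp
  have v1 := h.var2 hc (hp.smul s) hd
  have v2 := h.var2 hc hd (hp.smul (-s))
  have n1 : ⟪T z a, T z a⟫ = s ^ 2 * ⟪a, a⟫ := by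
    rw [h.sk hc, ha, inner_neg_right, real_inner_smul_right]; ring
  have n2 : ⟪T z (T z a), a⟫ = - (s ^ 2 * ⟪a, a⟫) := by
    rw [ha, inner_neg_left, real_inner_smul_left]
  have n3 : s * ⟪T z a, T z a⟫ = s ^ 2 * ⟪T y a, T y a⟫ + s ^ 2 * ⟪T x a, T x a⟫ := by
    have e3 : T z a = T x (T y a) - T y (T x a) := by rw [h.xyc]; abel
    have : ⟪T z a, T z a⟫ = ⟪T x (T y a), T z a⟫ - ⟪T y (T x a), T z a⟫ := by
      rw [← inner_sub_left, ← e3]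
    rw [this, h.sk hc x, h.sk hc y (T x a), e1, e2, inner_neg_right, real_inner_smul_right,
      real_inner_smul_right]
    ring
  have q1 : T x (T z a) - T y (s • a) = (-(2 * s)) • T y a := by
    rw [e1, map_smul]; module
  have q2 : T x ((-s) • a) - T y (T z a) = (-(2 * s)) • T x a := by
    rw [e2, map_smul]; module
  rw [q1] at v1
  rw [q2] at v2
  simp only [map_smul, real_inner_smul_left, real_inner_smul_right, n1, n2] at v1 v2
  have pos : 0 < ⟪a, a⟫ := by
    rcases (real_inner_self_nonneg (x := a)).lt_or_eq with h1 | h1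
    · exact h1
    · exact absurd (inner_self_eq_zero.1 h1.symm) h0
  rw [n1] at n3
  by_contra hcon
  push Not at hcon
  have : 0 < s ^ 2 * ⟪a, a⟫ := by positivity
  nlinarith

theorem Tri.half_exact (h : Tri g T x y z) (hc : Ctx g) {a : V} (hp : Perp x y z a) {s : ℝ}
    (hs : 0 < s) (ha : T z (T z a) = -(s ^ 2 • a)) (h0 : a ≠ 0) : s = 1 / 2 := by
  have hle := h.half_bound hc hp hs ha h0
  by_contra hne
  have hlt : s < 1 / 2 := lt_of_le_of_ne hle hne
  obtain ⟨e1, e2⟩ := h.raise hs ha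
  have ha' : T z (T z a) = -((-s) ^ 2 • a) := by rw [ha]; ring_nf
  have u1 := h.up1 ha'
  have u2 := h.up2 ha'
  have hd := h.perpz hc hp
  have l1 : T x (T z a) + (-s) • T y a = 0 := by
    by_contra hn
    have := h.half_bound hc (s := 1 + (-s)) ((h.perpx hc hd).add ((h.perpy hc hp).smul (-s)))
      (by linarith) (by rw [u1, map_neg, map_smul, u2]; module) hn
    linarith
  have l2 : (-s) • T x a - T y (T z a) = 0 := by
    by_contra hn
    have := h.half_bound hc (s := 1 + (-s)) (((h.perpx hc hp).smul (-s)).sub (h.perpy hc hd))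
      (by linarith) (by rw [u2, map_smul, u1]; module) hn
    linarith
  rw [e1] at l1
  rw [e2] at l2
  have l1' : (-(2 * s)) • T y a = 0 := by rw [← l1]; module
  have l2' : (-(2 * s)) • T x a = 0 := by rw [← l2]; module
  have m1 : T y a = 0 := (smul_eq_zero.1 l1').resolve_left (by linarith)
  have m2 : T x a = 0 := (smul_eq_zero.1 l2').resolve_left (by linarith)
  have m3 : T z a = 0 := by
    have := h.xyc a
    rw [m1, m2] at this
    simpa using this.symm
  rw [m3, map_zero] at ha
  have : s ^ 2 • a = 0 := by rw [← neg_eq_zero, ← ha]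
  rcases smul_eq_zero.1 this with h1 | h1
  · have : 0 < s ^ 2 := by positivity
    linarith
  · exact h0 h1

theorem Tri.zero_vec (h : Tri g T x y z) (hc : Ctx g) {a : V} (hp : Perp x y z a)
    (ha : T z a = 0) : T x a = 0 ∧ T y a = 0 := by
  have e1 : T z (T x a) = T y a := by rw [h.zxc, ha]; simp
  have e2 : T z (T y a) = - T x a := by rw [h.zyc, ha]; simp
  have m : T x a = 0 := by
    by_contra hn
    have := h.half_bound hc (s := 1) (h.perpx hc hp) one_pos (by rw [e1, e2]; simp) hn
    norm_num at this
  exact ⟨m, by rw [← e1, m, map_zero]⟩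

/-- Orthogonal projection off the triple. -/
def prE (x y z : V) : V →ₗ[ℝ] V :=
  LinearMap.id - (innerₗ V x).smulRight x - (innerₗ V y).smulRight y - (innerₗ V z).smulRight z

theorem prE_apply (x y z u : V) :
    prE x y z u = u - ⟪x, u⟫ • x - ⟪y, u⟫ • y - ⟪z, u⟫ • z := by
  simp [prE]

theorem Tri.yx (h : Tri g T x y z) : ⟪y, x⟫ = 0 := by rw [real_inner_comm]; exact h.xy
theorem Tri.zy (h : Tri g T x y z) : ⟪z, y⟫ = 0 := by rw [real_inner_comm]; exact h.yz
theorem Tri.xz (h : Tri g T x y z) : ⟪x, z⟫ = 0 := by rw [real_inner_comm]; exact h.zx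

theorem Tri.prE_perp (h : Tri g T x y z) (u : V) : Perp x y z (prE x y z u) := by
  refine ⟨?_, ?_, ?_⟩ <;>
  · simp only [prE_apply, inner_sub_right, real_inner_smul_right, h.nx, h.ny, h.nz, h.xy, h.yz,
      h.zx, h.yx, h.zy, h.xz]
    ring

theorem Tri.prE_comm (h : Tri g T x y z) (hc : Ctx g) (u : V) :
    prE x y z (T z u) = T z (prE x y z u) := by
  have a1 : ⟪x, T z u⟫ = -⟪y, u⟫ := by
    have := h.sk hc z x u; rw [h.Tzx] at this; linarith
  have a2 : ⟪y, T z u⟫ = ⟪x, u⟫ := by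
    have := h.sk hc z y u; rw [h.Tzy, inner_neg_left] at this; linarith
  have a3 : ⟪z, T z u⟫ = 0 := by
    have := h.sk hc z z u; rw [h.mem.2, inner_zero_left] at this; linarith
  simp only [prE_apply, a1, a2, a3, map_sub, map_smul, h.Tzx, h.Tzy, h.mem.2]
  module

theorem Tri.cubic (h : Tri g T x y z) (hc : Ctx g) (u : V) :
    T z (T z (T z (prE x y z u))) = -((1/4 : ℝ) • T z (prE x y z u)) := by
  have hsym : (T z ∘ₗ T z).IsSymmetric := by
    intro a b
    simp only [LinearMap.comp_apply]
    rw [h.sk hc, h.sk hc, neg_neg]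
  let b := hsym.eigenvectorBasis (n := Module.finrank ℝ V) rfl
  have key : T z ∘ₗ T z ∘ₗ T z ∘ₗ prE x y z = -((1/4 : ℝ) • (T z ∘ₗ prE x y z)) := by
    refine b.toBasis.ext fun i => ?_
    simp only [LinearMap.comp_apply, LinearMap.neg_apply, LinearMap.smul_apply,
      OrthonormalBasis.coe_toBasis]
    have hb : T z (T z (b i)) = (hsym.eigenvalues (n := Module.finrank ℝ V) rfl i) • b i := by
      have := hsym.apply_eigenvectorBasis (n := Module.finrank ℝ V) rfl i
      exact this
    set l := hsym.eigenvalues (n := Module.finrank ℝ V) rfl i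
    have hpp := h.prE_perp (b i)
    have hl : T z (T z (prE x y z (b i))) = l • prE x y z (b i) := by
      rw [← h.prE_comm hc, ← h.prE_comm hc, hb, map_smul]
    set a := prE x y z (b i)
    have hn : ⟪T z a, T z a⟫ = - l * ⟪a, a⟫ := by
      rw [h.sk hc, hl, real_inner_smul_right]; ring
    by_cases h0 : a = 0
    · simp [h0]
    rcases lt_trichotomy l 0 with h1 | h1 | h1
    · have hsq : (Real.sqrt (-l)) ^ 2 = -l := Real.sq_sqrt (by linarith)
      have hs := h.half_exact hc hpp (s := Real.sqrt (-l)) (Real.sqrt_pos.2 (by linarith))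
        (by rw [hl, hsq]; module) h0
      rw [hs] at hsq
      have : l = -(1/4) := by linarith
      rw [hl, this, map_smul]; module
    · have : T z a = 0 := by
        rw [h1, neg_zero, zero_mul] at hn
        exact inner_self_eq_zero.1 hn
      simp [this]
    · have p1 : (0:ℝ) ≤ ⟪T z a, T z a⟫ := real_inner_self_nonneg
      have p2 : (0:ℝ) ≤ ⟪a, a⟫ := real_inner_self_nonneg
      have : ⟪a, a⟫ = 0 := by nlinarith
      exact absurd (inner_self_eq_zero.1 this) h0
  have := congrArg (fun f => f u) key
  simpa using this

theorem prE_of_perp {x y z u : V} (hu : Perp x y z u) : prE x y z u = u := by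
  obtain ⟨a, b, c⟩ := hu
  simp [prE_apply, a, b, c]

theorem Tri.cubic' (h : Tri g T x y z) (hc : Ctx g) {u : V} (hu : Perp x y z u) :
    T z (T z (T z u)) = -((1/4 : ℝ) • T z u) := by
  have := h.cubic hc u
  rwa [prE_of_perp hu] at this

end Spin

/-- vectors of spin one half -/
def Half (T : V →ₗ[ℝ] V →ₗ[ℝ] V) (x y z u : V) : Prop :=
  Perp x y z u ∧ T z (T z u) = -((1/4 : ℝ) • u)

/-- vectors of spin zero -/
def Zer (T : V →ₗ[ℝ] V →ₗ[ℝ] V) (x y z u : V) : Prop :=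
  Perp x y z u ∧ T x u = 0 ∧ T y u = 0 ∧ T z u = 0

section Spin2
variable {g : Submodule ℝ (V →ₗ[ℝ] V)} {T : V →ₗ[ℝ] V →ₗ[ℝ] V} {x y z : V}

theorem Zer.cyc {u : V} (h : Zer T x y z u) : Zer T y z x u :=
  ⟨h.1.cyc, h.2.2.1, h.2.2.2, h.2.1⟩

theorem Tri.half_cyc (h : Tri g T x y z) (hc : Ctx g) {u : V} (hu : Half T x y z u) :
    Half T y z x u := by
  refine ⟨hu.1.cyc, ?_⟩
  have c := h.cyc.cubic' hc hu.1.cyc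
  set k := u + (4 : ℝ) • T x (T x u) with hk
  have k1 : T x k = 0 := by rw [hk, map_add, map_smul, c]; module
  have kp : Perp y z x k := hu.1.cyc.add (((h.perpx hc (h.perpx hc hu.1)).cyc).smul 4)
  obtain ⟨_, k2⟩ := h.cyc.zero_vec hc kp k1
  have e1 : ⟪k, T x (T x u)⟫ = 0 := by
    have := h.sk hc x k (T x u); rw [k1, inner_zero_left] at this; linarith
  have e2 : ⟪k, T z (T z u)⟫ = 0 := by
    have := h.sk hc z k (T z u); rw [k2, inner_zero_left] at this; linarith
  rw [hu.2, inner_neg_right, real_inner_smul_right] at e2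
  have e3 : ⟪k, k⟫ = 0 := by
    nth_rewrite 2 [hk]
    rw [inner_add_right, real_inner_smul_right, e1]; linarith
  have e4 : k = 0 := inner_self_eq_zero.1 e3
  rw [hk] at e4
  have e5 : (4 : ℝ) • (T x (T x u)) = - u := eq_neg_of_add_eq_zero_right e4
  calc T x (T x u) = (1/4 : ℝ) • ((4 : ℝ) • (T x (T x u))) := by module
    _ = _ := by rw [e5]; module

theorem Half.add {u v : V} (hu : Half T x y z u) (hv : Half T x y z v) :
    Half T x y z (u + v) := ⟨hu.1.add hv.1, by simp only [map_add, hu.2, hv.2]; module⟩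
theorem Half.sub {u v : V} (hu : Half T x y z u) (hv : Half T x y z v) :
    Half T x y z (u - v) := ⟨hu.1.sub hv.1, by simp only [map_sub, hu.2, hv.2]; module⟩
theorem Half.smul {u : V} (hu : Half T x y z u) (r : ℝ) :
    Half T x y z (r • u) := ⟨hu.1.smul r, by simp only [map_smul, hu.2]; module⟩

theorem Tri.hxz (h : Tri g T x y z) {u : V} (hu : Half T x y z u) :
    T x (T z u) = -((1/2 : ℝ) • T y u) :=
  (h.raise (s := 1/2) (by norm_num) (by rw [hu.2]; module)).1
theorem Tri.hyz (h : Tri g T x y z) {u : V} (hu : Half T x y z u) :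
    T y (T z u) = (1/2 : ℝ) • T x u :=
  (h.raise (s := 1/2) (by norm_num) (by rw [hu.2]; module)).2
theorem Tri.hzx (h : Tri g T x y z) {u : V} (hu : Half T x y z u) :
    T z (T x u) = (1/2 : ℝ) • T y u := by rw [h.zxc, h.hxz hu]; module
theorem Tri.hzy (h : Tri g T x y z) {u : V} (hu : Half T x y z u) :
    T z (T y u) = -((1/2 : ℝ) • T x u) := by rw [h.zyc, h.hyz hu]; module
theorem Tri.hxy (h : Tri g T x y z) (hc : Ctx g) {u : V} (hu : Half T x y z u) :
    T x (T y u) = (1/2 : ℝ) • T z u :=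
  h.cyc.cyc.hyz (h.cyc.half_cyc hc (h.half_cyc hc hu))
theorem Tri.hyx (h : Tri g T x y z) (hc : Ctx g) {u : V} (hu : Half T x y z u) :
    T y (T x u) = -((1/2 : ℝ) • T z u) := h.cyc.hxz (h.half_cyc hc hu) 
theorem Tri.hxx (h : Tri g T x y z) (hc : Ctx g) {u : V} (hu : Half T x y z u) :
    T x (T x u) = -((1/4 : ℝ) • u) := (h.half_cyc hc hu).2
theorem Tri.hyy (h : Tri g T x y z) (hc : Ctx g) {u : V} (hu : Half T x y z u) :
    T y (T y u) = -((1/4 : ℝ) • u) := (h.cyc.half_cyc hc (h.half_cyc hc hu)).2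

theorem Tri.halfx (h : Tri g T x y z) (hc : Ctx g) {u : V} (hu : Half T x y z u) :
    Half T x y z (T x u) :=
  ⟨h.perpx hc hu.1, by rw [h.hzx hu, map_smul, h.hzy hu]; module⟩
theorem Tri.halfy (h : Tri g T x y z) (hc : Ctx g) {u : V} (hu : Half T x y z u) :
    Half T x y z (T y u) :=
  ⟨h.perpy hc hu.1, by rw [h.hzy hu, map_neg, map_smul, h.hzx hu]; module⟩
theorem Tri.halfz (h : Tri g T x y z) (hc : Ctx g) {u : V} (hu : Half T x y z u) :
    Half T x y z (T z u) :=
  ⟨h.perpz hc hu.1, by rw [hu.2, map_neg, map_smul]⟩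

theorem Tri.half_zero (h : Tri g T x y z) (hc : Ctx g) {u v : V} (hu : Half T x y z u)
    (hv : Zer T x y z v) : ⟪u, v⟫ = 0 := by
  have e := h.sk hc z (T z u) v
  rw [hv.2.2.2, inner_zero_right, hu.2, inner_neg_left, real_inner_smul_left] at e
  linarith
theorem Tri.zero_half (h : Tri g T x y z) (hc : Ctx g) {u v : V} (hu : Half T x y z u)
    (hv : Zer T x y z v) : ⟪v, u⟫ = 0 := by
  rw [real_inner_comm]; exact h.half_zero hc hu hv

/-- half-spin component -/
def hp (T : V →ₗ[ℝ] V →ₗ[ℝ] V) (x y z : V) : V →ₗ[ℝ] V :=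
  (-4 : ℝ) • (T z ∘ₗ T z ∘ₗ prE x y z)
/-- spin zero component -/
def zp (T : V →ₗ[ℝ] V →ₗ[ℝ] V) (x y z : V) : V →ₗ[ℝ] V := prE x y z - hp T x y z

theorem Tri.hp_half (h : Tri g T x y z) (hc : Ctx g) (u : V) : Half T x y z (hp T x y z u) := by
  have hp0 := h.prE_perp u
  refine ⟨(h.perpz hc (h.perpz hc hp0)).smul _, ?_⟩
  simp only [hp, LinearMap.smul_apply, LinearMap.comp_apply, map_smul]
  rw [h.cubic hc, map_neg, map_smul]; module

theorem Tri.zp_zero (h : Tri g T x y z) (hc : Ctx g) (u : V) : Zer T x y z (zp T x y z u) := by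
  have hp0 := h.prE_perp u
  have hpp : Perp x y z (zp T x y z u) := hp0.sub (h.hp_half hc u).1
  have hz : T z (zp T x y z u) = 0 := by
    simp only [zp, hp, LinearMap.sub_apply, LinearMap.smul_apply, LinearMap.comp_apply, map_smul,
      map_sub]
    rw [h.cubic hc]; module
  obtain ⟨a, b⟩ := h.zero_vec hc hpp hz
  exact ⟨hpp, a, b, hz⟩

theorem decomp (T : V →ₗ[ℝ] V →ₗ[ℝ] V) (x y z u : V) :
    u = ⟪x, u⟫ • x + ⟪y, u⟫ • y + ⟪z, u⟫ • z + zp T x y z u + hp T x y z u := by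
  simp only [zp, LinearMap.sub_apply, prE_apply]; module

theorem Tri.ext_vec (h : Tri g T x y z) (hc : Ctx g) {v : V} (h1 : ⟪x, v⟫ = 0) (h2 : ⟪y, v⟫ = 0)
    (h3 : ⟪z, v⟫ = 0) (h4 : ∀ u, Zer T x y z u → ⟪u, v⟫ = 0)
    (h5 : ∀ u, Half T x y z u → ⟪u, v⟫ = 0) : v = 0 := by
  have : ⟪v, v⟫ = 0 := by
    nth_rewrite 1 [decomp T x y z v]
    simp only [inner_add_left, real_inner_smul_left, h1, h2, h3, h4 _ (h.zp_zero hc v),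
      h5 _ (h.hp_half hc v)]
    ring
  exact inner_self_eq_zero.1 this

theorem Tri.ext_map (h : Tri g T x y z) (hc : Ctx g) {D : V →ₗ[ℝ] V} (h1 : D x = 0) (h2 : D y = 0)
    (h3 : D z = 0) (h4 : ∀ u, Zer T x y z u → D u = 0)
    (h5 : ∀ u, Half T x y z u → D u = 0) : D = 0 := by
  ext v
  rw [decomp T x y z v]
  simp only [map_add, map_smul, h1, h2, h3, h4 _ (h.zp_zero hc v), h5 _ (h.hp_half hc v)]
  simp

theorem IsSkew.flip {D : V →ₗ[ℝ] V} (hD : IsSkew D) {u v : V} (h : ⟪u, D v⟫ = 0) :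
    ⟪v, D u⟫ = 0 := by
  have := hD u v
  rw [h, real_inner_comm] at this; linarith

theorem IsSkew.self {D : V →ₗ[ℝ] V} (hD : IsSkew D) (u : V) : ⟪u, D u⟫ = 0 := by
  have := hD u u
  rw [real_inner_comm] at this; linarith

/-- A skew map all of whose blocks vanish is zero. -/
theorem Tri.block (h : Tri g T x y z) (hc : Ctx g) {D : V →ₗ[ℝ] V} (hD : IsSkew D)
    (hxy : ⟪y, D x⟫ = 0) (hyz : ⟪z, D y⟫ = 0) (hzx : ⟪x, D z⟫ = 0)
    (h0 : ∀ u, Zer T x y z u → ⟪u, D x⟫ = 0 ∧ ⟪u, D y⟫ = 0 ∧ ⟪u, D z⟫ = 0)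
    (h1 : ∀ u, Half T x y z u → ⟪u, D x⟫ = 0 ∧ ⟪u, D y⟫ = 0 ∧ ⟪u, D z⟫ = 0)
    (h00 : ∀ u v, Zer T x y z u → Zer T x y z v → ⟪u, D v⟫ = 0)
    (h10 : ∀ u v, Half T x y z u → Zer T x y z v → ⟪u, D v⟫ = 0)
    (h11 : ∀ u v, Half T x y z u → Half T x y z v → ⟪u, D v⟫ = 0) : D = 0 := by
  refine h.ext_map hc ?_ ?_ ?_ ?_ ?_
  · exact h.ext_vec hc (hD.self x) hxy (hD.flip hzx) (fun u hu => (h0 u hu).1)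
      (fun u hu => (h1 u hu).1)
  · exact h.ext_vec hc (hD.flip hxy) (hD.self y) hyz (fun u hu => (h0 u hu).2.1)
      (fun u hu => (h1 u hu).2.1)
  · exact h.ext_vec hc hzx (hD.flip hyz) (hD.self z) (fun u hu => (h0 u hu).2.2)
      (fun u hu => (h1 u hu).2.2)
  · intro v hv
    exact h.ext_vec hc (hD.flip (h0 v hv).1) (hD.flip (h0 v hv).2.1) (hD.flip (h0 v hv).2.2)
      (fun u hu => h00 u v hu hv) (fun u hu => h10 u v hu hv)
  · intro v hv
    exact h.ext_vec hc (hD.flip (h1 v hv).1) (hD.flip (h1 v hv).2.1) (hD.flip (h1 v hv).2.2)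
      (fun u hu => hD.flip (h10 v u hv hu)) (fun u hu => h11 u v hu hv)

end Spin2

/-- irreducibility -/
def Irr (g : Submodule ℝ (V →ₗ[ℝ] V)) : Prop :=
  ∀ W : Submodule ℝ V, (∀ A ∈ g, ∀ x ∈ W, A x ∈ W) → W = ⊥ ∨ W = ⊤

/-- all skew maps are in g -/
def FullSo (g : Submodule ℝ (V →ₗ[ℝ] V)) : Prop := ∀ A : V →ₗ[ℝ] V, IsSkew A → A ∈ g

theorem w2_add_right (a b c : V) : w2 a (b + c) = w2 a b + w2 a c := by
  ext u; simp only [LinearMap.add_apply, w2_apply, inner_add_left]; module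
theorem w2_sub_right (a b c : V) : w2 a (b - c) = w2 a b - w2 a c := by
  ext u; simp only [LinearMap.sub_apply, w2_apply, inner_sub_left]; module
theorem w2_smul_right (a b : V) (r : ℝ) : w2 a (r • b) = r • w2 a b := by
  ext u; simp only [LinearMap.smul_apply, w2_apply, real_inner_smul_left]; module
theorem w2_neg_right (a b : V) : w2 a (-b) = - w2 a b := by
  ext u; simp only [LinearMap.neg_apply, w2_apply, inner_neg_left]; module
theorem w2_add_left (a b c : V) : w2 (a + b) c = w2 a c + w2 b c := by
  ext u; simp only [LinearMap.add_apply, w2_apply, inner_add_left]; module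
theorem w2_sub_left (a b c : V) : w2 (a - b) c = w2 a c - w2 b c := by
  ext u; simp only [LinearMap.sub_apply, w2_apply, inner_sub_left]; module
theorem w2_smul_left (a b : V) (r : ℝ) : w2 (r • a) b = r • w2 a b := by
  ext u; simp only [LinearMap.smul_apply, w2_apply, real_inner_smul_left]; module
theorem w2_neg_left (a b : V) : w2 (-a) b = - w2 a b := by
  ext u; simp only [LinearMap.neg_apply, w2_apply, inner_neg_left]; module
theorem w2_swap (a b : V) : w2 a b = - w2 b a := by
  ext u; simp only [LinearMap.neg_apply, w2_apply]; module
theorem w2_self (a : V) : w2 a a = 0 := by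
  ext u; simp only [LinearMap.zero_apply, w2_apply]; module
theorem w2_zero_left (a : V) : w2 0 a = 0 := by
  ext u; simp [w2_apply]
theorem w2_zero_right (a : V) : w2 a 0 = 0 := by
  ext u; simp [w2_apply]

section Full
variable {g : Submodule ℝ (V →ₗ[ℝ] V)}

theorem w2_mem_swap {a b : V} (h : w2 a b ∈ g) : w2 b a ∈ g := by
  rw [w2_swap]; exact g.neg_mem h

theorem Ctx.brw (hc : Ctx g) {A : V →ₗ[ℝ] V} (hA : A ∈ g) {a b : V} (h : w2 a b ∈ g) :
    w2 (A a) b + w2 a (A b) ∈ g := by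
  rw [← br_w2 (hc.skew A hA)]; exact hc.lie A hA _ h

theorem full_aux (hc : Ctx g) {x y z : V} (nx : ⟪x, x⟫ = 1) (ny : ⟪y, y⟫ = 1) (nz : ⟪z, z⟫ = 1)
    (xy : ⟪x, y⟫ = 0) (yz : ⟪y, z⟫ = 0) (zx : ⟪z, x⟫ = 0)
    (mxy : w2 x y ∈ g) (myz : w2 y z ∈ g) (mzx : w2 z x ∈ g) {A : V →ₗ[ℝ] V} (hA : A ∈ g) :
    w2 x (A x) ∈ g ∧ w2 y (A x) ∈ g ∧ w2 z (A x) ∈ g := by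
  have yx : ⟪y, x⟫ = 0 := by rw [real_inner_comm]; exact xy
  have zy : ⟪z, y⟫ = 0 := by rw [real_inner_comm]; exact yz
  have xz : ⟪x, z⟫ = 0 := by rw [real_inner_comm]; exact zx
  have b1 := hc.brw hA mxy
  have b2 := hc.lie _ myz _ b1
  rw [LinearMap.comp_add, LinearMap.add_comp, add_sub_add_comm, br_w2 (w2_skew _ _),
    br_w2 (w2_skew _ _)] at b2
  simp only [w2_apply, nx, ny, nz, xy, yz, zx, yx, zy, xz, zero_smul, one_smul, sub_zero,
    zero_sub, w2_zero_left, w2_sub_left, w2_sub_right, w2_smul_left, w2_smul_right, w2_self,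
    smul_zero] at b2
  set a := A x
  set b := A y
  have hza : w2 z a ∈ g := by
    have e : w2 z a = -(⟪y, a⟫ • w2 z y + w2 a z + (0 + (⟪y, b⟫ • w2 x z - ⟪z, b⟫ • w2 x y)))
        + (⟪y, a⟫ • (- w2 y z) + (⟪y, b⟫ • (- w2 z x) - ⟪z, b⟫ • w2 x y)) := by
      rw [w2_swap z a, w2_swap z y, w2_swap x z]; module
    rw [e]
    refine g.add_mem (g.neg_mem b2) (g.add_mem (g.smul_mem _ (g.neg_mem myz)) (g.sub_mem
      (g.smul_mem _ (g.neg_mem mzx)) (g.smul_mem _ mxy)))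
  have b3 := hc.brw myz hza
  have b4 := hc.brw mzx hza
  simp only [w2_apply, nx, ny, nz, xy, yz, zx, yx, zy, xz, zero_smul, one_smul, sub_zero,
    zero_sub, w2_zero_left, w2_sub_left, w2_sub_right, w2_smul_left, w2_smul_right, w2_self,
    smul_zero, w2_neg_left] at b3 b4
  refine ⟨?_, ?_, hza⟩
  · have e : w2 x a = (w2 x a + ⟪z, a⟫ • w2 z x) - ⟪z, a⟫ • w2 z x := by module
    rw [e]; exact g.sub_mem b4 (g.smul_mem _ mzx)
  · have e : w2 y a = -(-w2 y a + -(⟪z, a⟫ • w2 z y)) + ⟪z, a⟫ • w2 y z := by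
      rw [w2_swap z y]; module
    rw [e]; exact g.add_mem (g.neg_mem b3) (g.smul_mem _ myz)

theorem full_of_so3 (hc : Ctx g) (hirr : Irr g) {x y z : V} (nx : ⟪x, x⟫ = 1) (ny : ⟪y, y⟫ = 1)
    (nz : ⟪z, z⟫ = 1) (xy : ⟪x, y⟫ = 0) (yz : ⟪y, z⟫ = 0) (zx : ⟪z, x⟫ = 0)
    (mxy : w2 x y ∈ g) (myz : w2 y z ∈ g) (mzx : w2 z x ∈ g) : FullSo g := by
  let U : Submodule ℝ V :=
    { carrier := {u | w2 x u ∈ g ∧ w2 y u ∈ g ∧ w2 z u ∈ g}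
      add_mem' := by
        rintro a b ⟨h1, h2, h3⟩ ⟨h4, h5, h6⟩
        exact ⟨by rw [w2_add_right]; exact g.add_mem h1 h4,
          by rw [w2_add_right]; exact g.add_mem h2 h5, by rw [w2_add_right]; exact g.add_mem h3 h6⟩
      zero_mem' := by simp [w2_zero_right]
      smul_mem' := by
        rintro r b ⟨h1, h2, h3⟩
        exact ⟨by rw [w2_smul_right]; exact g.smul_mem _ h1,
          by rw [w2_smul_right]; exact g.smul_mem _ h2,
          by rw [w2_smul_right]; exact g.smul_mem _ h3⟩ }
  have hxU : x ∈ U := ⟨by rw [w2_self]; exact g.zero_mem, w2_mem_swap mxy, mzx⟩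
  have hAx : ∀ A ∈ g, A x ∈ U := fun A hA => full_aux hc nx ny nz xy yz zx mxy myz mzx hA
  have hAy : ∀ A ∈ g, A y ∈ U := fun A hA => by
    obtain ⟨h1, h2, h3⟩ := full_aux hc ny nz nx yz zx xy myz mzx mxy hA
    exact ⟨h3, h1, h2⟩
  have hAz : ∀ A ∈ g, A z ∈ U := fun A hA => by
    obtain ⟨h1, h2, h3⟩ := full_aux hc nz nx ny zx xy yz mzx mxy myz hA
    exact ⟨h2, h3, h1⟩
  have huv : ∀ u ∈ U, ∀ v ∈ U, w2 u v ∈ g := by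
    rintro u ⟨hu, -, -⟩ v ⟨hv, -, -⟩
    have b := hc.brw (w2_mem_swap hu) hv
    simp only [w2_apply, nx, one_smul, w2_sub_left, w2_sub_right, w2_smul_left, w2_smul_right,
      w2_self, smul_zero, zero_sub] at b
    have e : w2 u v = -(⟪u, x⟫ • w2 x v - w2 u v + -(⟪x, v⟫ • w2 x u)) +
      (⟪u, x⟫ • w2 x v - ⟪x, v⟫ • w2 x u) := by module
    rw [e]
    exact g.add_mem (g.neg_mem b) (g.sub_mem (g.smul_mem _ hv) (g.smul_mem _ hu))
  have hinv : ∀ A ∈ g, ∀ u ∈ U, A u ∈ U := by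
    intro A hA u hu
    have key : ∀ w, A w ∈ U → w2 w u ∈ g → w2 w (A u) ∈ g := by
      intro w hw hwu
      have b := hc.brw hA hwu
      have e : w2 w (A u) = (w2 (A w) u + w2 w (A u)) - w2 (A w) u := by module
      rw [e]; exact g.sub_mem b (huv _ hw _ hu)
    exact ⟨key x (hAx A hA) hu.1, key y (hAy A hA) hu.2.1, key z (hAz A hA) hu.2.2⟩
  have hU : U = ⊤ := by
    rcases hirr U hinv with h | h
    · rw [h] at hxU
      rw [(Submodule.mem_bot ℝ).1 hxU, inner_zero_left] at nx
      norm_num at nx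
    · exact h
  have hall : ∀ u v, w2 u v ∈ g := fun u v => huv u (hU ▸ trivial) v (hU ▸ trivial)
  intro A hA
  let e := stdOrthonormalBasis ℝ V
  have key : A = (1/2 : ℝ) • ∑ i, w2 (e i) (A (e i)) := by
    ext u
    simp only [LinearMap.smul_apply, LinearMap.sum_apply, w2_apply, Finset.sum_sub_distrib]
    have e1 : ∑ i, ⟪e i, u⟫ • A (e i) = A u := by
      conv_rhs => rw [← e.sum_repr' u]
      simp
    have e2 : ∑ i, ⟪A (e i), u⟫ • e i = - A u := by
      conv_rhs => rw [← e.sum_repr' (A u)]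
      rw [← Finset.sum_neg_distrib]
      refine Finset.sum_congr rfl fun i _ => ?_
      rw [hA]; module
    rw [e1, e2]; module
  rw [key]
  exact g.smul_mem _ (g.sum_mem fun i _ => hall _ _)

end Full

section LemR
variable {g : Submodule ℝ (V →ₗ[ℝ] V)} {T : V →ₗ[ℝ] V →ₗ[ℝ] V} {x y z : V}

theorem Tri.full (h : Tri g T x y z) (hc : Ctx g) (hirr : Irr g) (myz : w2 y z ∈ g) :
    FullSo g := by
  have mzx : w2 z x ∈ g := by
    have b := hc.brw (h.mem.1 z) myz
    rw [h.Tzy, h.mem.2, w2_zero_right, add_zero, w2_neg_left, ← w2_swap] at b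
    exact b
  have mxy : w2 x y ∈ g := by
    have b := hc.brw (h.mem.1 x) mzx
    rw [h.Txz, h.mem.2, w2_zero_right, add_zero, w2_neg_left, ← w2_swap] at b
    exact b
  exact full_of_so3 hc hirr h.nx h.ny h.nz h.xy h.yz h.zx mxy myz mzx

theorem inner_pos_of_ne {u : V} (h : u ≠ 0) : 0 < ⟪u, u⟫ := by
  rcases (real_inner_self_nonneg (x := u)).lt_or_eq with h1 | h1
  · exact h1
  · exact absurd (inner_self_eq_zero.1 h1.symm) h

theorem mem_of_smul_mem {A : V →ₗ[ℝ] V} {r : ℝ} (hr : r ≠ 0) (h : r • A ∈ g) : A ∈ g := by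
  have := g.smul_mem r⁻¹ h
  rwa [smul_smul, inv_mul_cancel₀ hr, one_smul] at this

theorem Tri.lemR (h : Tri g T x y z) (hc : Ctx g) (hirr : Irr g) {u : V} (hu : Half T x y z u)
    (h0 : u ≠ 0) (hm : w2 z u ∈ g) : FullSo g := by
  have hu2 := h.halfz hc hu
  have hu3 := h.halfx hc hu
  obtain ⟨ux, uy, uz⟩ := hu.1
  obtain ⟨mx, my, mz⟩ := hu2.1
  have b1 := hc.brw (h.mem.1 z) hm
  rw [h.mem.2, w2_zero_left, zero_add] at b1
  set m := T z u with hmd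
  have um : ⟪u, m⟫ = 0 := (hc.skew _ (h.mem.1 z)).self u
  have b2 := hc.brw hm b1
  rw [w2_apply, w2_apply, h.nz, real_inner_comm, uz, mz, um] at b2
  simp only [one_smul, zero_smul, sub_zero, w2_zero_right, add_zero] at b2
  have b3 := hc.brw (h.mem.1 x) hm
  rw [h.Txz, w2_neg_left] at b3
  have b4 := hc.lie _ b2 _ b3
  have u1 : ⟪u, T x u⟫ = 0 := (hc.skew _ (h.mem.1 x)).self u
  have u2 : ⟪m, T x u⟫ = 0 := by
    rw [hmd, h.sk hc, h.hzx hu, real_inner_smul_right, (hc.skew _ (h.mem.1 y)).self u]; ring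
  have w1 : w2 u m y = 0 := by
    rw [w2_apply, real_inner_comm, uy, real_inner_comm, my]; simp
  have w3 : w2 u m z = 0 := by
    rw [w2_apply, real_inner_comm, uz, real_inner_comm, mz]; simp
  have w4 : w2 u m (T x u) = 0 := by rw [w2_apply, u1, u2]; simp
  have w5 : w2 u m u = ⟪u, u⟫ • m := by rw [w2_apply, real_inner_comm u m, um]; simp
  rw [← w2_neg_left, LinearMap.comp_add, LinearMap.add_comp, add_sub_add_comm,
    br_w2 (w2_skew _ _), br_w2 (w2_skew _ _), map_neg, w1, w3, w4, w5] at b4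
  simp only [neg_zero, w2_zero_left, w2_zero_right, w2_neg_left, zero_add, add_zero,
    w2_smul_right] at b4
  have pu := inner_pos_of_ne h0
  have b5 : w2 y m ∈ g := by
    refine mem_of_smul_mem (r := -⟪u, u⟫) (by linarith) ?_
    rw [neg_smul, ← smul_neg]; exact b4
  have b6 := hc.brw b5 b1
  have mm : ⟪m, m⟫ = 1/4 * ⟪u, u⟫ := by
    rw [hmd, h.sk hc, hu.2, inner_neg_right, real_inner_smul_right]; ring
  have w6 : w2 y m z = 0 := by
    rw [w2_apply, h.yz, real_inner_comm, mz]; simp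
  have w7 : w2 y m m = (-⟪m, m⟫) • y := by
    rw [w2_apply, my]; simp
  rw [w6, w7, w2_zero_left, zero_add, w2_smul_right] at b6
  exact h.full hc hirr (w2_mem_swap (mem_of_smul_mem (by rw [mm]; linarith) b6))

theorem Tri.no_half (h : Tri g T x y z) (hc : Ctx g) (hirr : Irr g)
    (hn : ∀ u, Half T x y z u → u = 0) : FullSo g := by
  refine h.full hc hirr ?_
  have : T x - w2 y z = 0 := by
    refine h.ext_map hc ?_ ?_ ?_ ?_ ?_
    · simp [w2_apply, h.mem.2, h.yx, h.zx]
    · simp only [LinearMap.sub_apply, w2_apply, h.ny, h.zy, h.Txy]; module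
    · simp only [LinearMap.sub_apply, w2_apply, h.nz, h.yz, h.Txz]; module
    · intro u hu
      simp [w2_apply, hu.2.1, hu.1.2.1, hu.1.2.2]
    · intro u hu
      rw [hn u hu, map_zero]
  rw [← sub_eq_zero.1 this]
  exact h.mem.1 x

end LemR

/-- commutator -/
def bk (A B : V →ₗ[ℝ] V) : V →ₗ[ℝ] V := A ∘ₗ B - B ∘ₗ A

theorem bk_apply (A B : V →ₗ[ℝ] V) (u : V) : bk A B u = A (B u) - B (A u) := rfl
theorem bk_add (A B C : V →ₗ[ℝ] V) : bk A (B + C) = bk A B + bk A C := by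
  ext u; simp only [bk_apply, LinearMap.add_apply, map_add]; abel
theorem bk_sub (A B C : V →ₗ[ℝ] V) : bk A (B - C) = bk A B - bk A C := by
  ext u; simp only [bk_apply, LinearMap.sub_apply, map_sub]; abel
theorem bk_smul (A B : V →ₗ[ℝ] V) (r : ℝ) : bk A (r • B) = r • bk A B := by
  ext u; simp only [bk_apply, LinearMap.smul_apply, map_smul]; module
theorem bk_neg (A B : V →ₗ[ℝ] V) : bk A (-B) = - bk A B := by
  ext u; simp only [bk_apply, LinearMap.neg_apply, map_neg]; abel
theorem bk_w2 {A : V →ₗ[ℝ] V} (hA : IsSkew A) (a b : V) :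
    bk A (w2 a b) = w2 (A a) b + w2 a (A b) := br_w2 hA a b

section CaseN
variable {g : Submodule ℝ (V →ₗ[ℝ] V)} {T : V →ₗ[ℝ] V →ₗ[ℝ] V} {x y z : V}

theorem Ctx.bk (hc : Ctx g) {A B : V →ₗ[ℝ] V} (hA : A ∈ g) (hB : B ∈ g) : bk A B ∈ g :=
  hc.lie A hA B hB

theorem Tri.zeta_half (h : Tri g T x y z) (hc : Ctx g) {ζ p : V} (hz : Zer T x y z ζ)
    (hp : Half T x y z p) : Half T x y z (T ζ p) := by
  have ex : ∀ v, T x (T ζ v) = T ζ (T x v) := fun v => by rw [h.ix, hz.2.1]; simp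
  have ey : ∀ v, T y (T ζ v) = T ζ (T y v) := fun v => by rw [h.iy, hz.2.2.1]; simp
  have ez : ∀ v, T z (T ζ v) = T ζ (T z v) := fun v => by rw [h.iz, hz.2.2.2]; simp
  refine ⟨⟨?_, ?_, ?_⟩, ?_⟩
  · have := h.sk hc ζ x p; rw [h.mem.anti, hz.2.1] at this; simpa using this
  · have := h.sk hc ζ y p; rw [h.mem.anti, hz.2.2.1] at this; simpa using this
  · have := h.sk hc ζ z p; rw [h.mem.anti, hz.2.2.2] at this; simpa using this
  · rw [ez, ez, hp.2, map_neg, map_smul]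

theorem Tri.hhh (h : Tri g T x y z) (hc : Ctx g) {a b c : V} (ha : Half T x y z a)
    (hb : Half T x y z b) (hcc : Half T x y z c) : ⟪T a b, c⟫ = 0 := by
  have E : ∀ a b c, ⟪T (T z a) b, c⟫ + ⟪T a (T z b), c⟫ + ⟪T a b, T z c⟫ = 0 := by
    intro a b c
    have := h.sk hc z (T a b) c
    rw [h.iz, inner_add_left] at this
    linarith
  have e1 := E (T z a) b c
  have e2 := E a (T z b) c
  have e3 := E a b (T z c)
  have e4 := E (T z a) (T z b) (T z c)
  rw [ha.2] at e1 e4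
  rw [hb.2] at e2 e4
  rw [hcc.2] at e3 e4
  simp only [map_neg, map_smul, LinearMap.neg_apply, LinearMap.smul_apply, inner_neg_left,
    inner_neg_right, real_inner_smul_left, real_inner_smul_right] at e1 e2 e3 e4
  linarith

set_option maxHeartbeats 2000000 in
theorem Tri.caseN (h : Tri g T x y z) (hc : Ctx g) (hirr : Irr g) {p : V} (hp : Half T x y z p)
    (h0 : p ≠ 0) (hN : w2 x p - w2 y ((2 : ℝ) • T z p) ∈ g) : FullSo g := by
  have sx := hc.skew _ (h.mem.1 x)
  have sy := hc.skew _ (h.mem.1 y)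
  have sz := hc.skew _ (h.mem.1 z)
  obtain ⟨i, hi⟩ : ∃ i, i = (2 : ℝ) • T x p := ⟨_, rfl⟩
  obtain ⟨j, hj⟩ : ∃ j, j = (2 : ℝ) • T y p := ⟨_, rfl⟩
  obtain ⟨k, hk⟩ : ∃ k, k = (2 : ℝ) • T z p := ⟨_, rfl⟩
  have xp : T x p = (1/2 : ℝ) • i := by rw [hi]; module
  have yp : T y p = (1/2 : ℝ) • j := by rw [hj]; module
  have zp : T z p = (1/2 : ℝ) • k := by rw [hk]; module
  have xi : T x i = (-1/2 : ℝ) • p := by rw [hi, map_smul, h.hxx hc hp]; module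
  have yj : T y j = (-1/2 : ℝ) • p := by rw [hj, map_smul, h.hyy hc hp]; module
  have zk : T z k = (-1/2 : ℝ) • p := by rw [hk, map_smul, hp.2]; module
  have xj : T x j = (1/2 : ℝ) • k := by rw [hj, hk, map_smul, h.hxy hc hp]
                                        module
  have xk : T x k = (-1/2 : ℝ) • j := by rw [hj, hk, map_smul, h.hxz hp]; module
  have yi : T y i = (-1/2 : ℝ) • k := by rw [hi, hk, map_smul, h.hyx hc hp]; module
  have yk : T y k = (1/2 : ℝ) • i := by rw [hi, hk, map_smul, h.hyz hp]; module
  have zi : T z i = (1/2 : ℝ) • j := by rw [hi, hj, map_smul, h.hzx hp]; module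
  have zj : T z j = (-1/2 : ℝ) • i := by rw [hi, hj, map_smul, h.hzy hp]; module
  have Hi : Half T x y z i := by rw [hi]; exact (h.halfx hc hp).smul 2
  have Hj : Half T x y z j := by rw [hj]; exact (h.halfy hc hp).smul 2
  have Hk : Half T x y z k := by rw [hk]; exact (h.halfz hc hp).smul 2
  have pi : ⟪p, i⟫ = 0 := by rw [hi, real_inner_smul_right, sx.self]; ring
  have pj : ⟪p, j⟫ = 0 := by rw [hj, real_inner_smul_right, sy.self]; ring
  have pk : ⟪p, k⟫ = 0 := by rw [hk, real_inner_smul_right, sz.self]; ring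
  have ij : ⟪i, j⟫ = 0 := by
    rw [hi, real_inner_smul_left, h.sk hc, xj, real_inner_smul_right, pk]; ring
  have jk : ⟪j, k⟫ = 0 := by
    rw [hj, real_inner_smul_left, h.sk hc, yk, real_inner_smul_right, pi]; ring
  have ik : ⟪i, k⟫ = 0 := by
    rw [hi, real_inner_smul_left, h.sk hc, xk, real_inner_smul_right, pj]; ring
  have ip : ⟪i, p⟫ = 0 := by rw [real_inner_comm]; exact pi
  have jp : ⟪j, p⟫ = 0 := by rw [real_inner_comm]; exact pj
  have kp : ⟪k, p⟫ = 0 := by rw [real_inner_comm]; exact pk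
  have ji : ⟪j, i⟫ = 0 := by rw [real_inner_comm]; exact ij
  have kj : ⟪k, j⟫ = 0 := by rw [real_inner_comm]; exact jk
  have ki : ⟪k, i⟫ = 0 := by rw [real_inner_comm]; exact ik
  obtain ⟨n, hn⟩ : ∃ n, n = ⟪p, p⟫ := ⟨_, rfl⟩
  have npos : 0 < n := hn ▸ inner_pos_of_ne h0
  have ii : ⟪i, i⟫ = n := by
    nth_rewrite 1 [hi]
    rw [real_inner_smul_left, h.sk hc, xi, real_inner_smul_right, hn]; ring
  have jj : ⟪j, j⟫ = n := by
    nth_rewrite 1 [hj]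
    rw [real_inner_smul_left, h.sk hc, yj, real_inner_smul_right, hn]; ring
  have kk : ⟪k, k⟫ = n := by
    nth_rewrite 1 [hk]
    rw [real_inner_smul_left, h.sk hc, zk, real_inner_smul_right, hn]; ring
  have hx0 : ∀ {u}, Perp x y z u → ⟪u, x⟫ = 0 := fun hu => by rw [real_inner_comm]; exact hu.1
  have hy0 : ∀ {u}, Perp x y z u → ⟪u, y⟫ = 0 := fun hu => by rw [real_inner_comm]; exact hu.2.1
  have hz0 : ∀ {u}, Perp x y z u → ⟪u, z⟫ = 0 := fun hu => by rw [real_inner_comm]; exact hu.2.2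
  rw [← hk] at hN
  have mx := h.mem.1 x
  have mz := h.mem.1 z
  -- the chain of brackets
  have hN1 : (1/2 : ℝ) • w2 x i + (1/2 : ℝ) • w2 y j - w2 z k ∈ g := by
    have := hc.bk mx hN
    rw [bk_sub, bk_w2 sx, bk_w2 sx, h.mem.2, h.Txy, xp, xk] at this
    simp only [w2_zero_left, w2_smul_right] at this
    convert this using 1
    module
  have hN2 : w2 y k + w2 z j ∈ g := by
    have := hc.bk mx hN1
    rw [bk_sub, bk_add, bk_smul, bk_smul, bk_w2 sx, bk_w2 sx, bk_w2 sx, h.mem.2, h.Txy, h.Txz, xi,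
      xj, xk] at this
    simp only [w2_zero_left, w2_smul_right, w2_neg_left] at this
    convert g.add_mem this (g.smul_mem (1/4) hN) using 1
    module
  have hN3 : w2 z k - w2 y j ∈ g := by
    have := hc.bk mx hN2
    rw [bk_add, bk_w2 sx, bk_w2 sx, h.Txy, h.Txz, xj, xk] at this
    simp only [w2_zero_left, w2_smul_right, w2_neg_left] at this
    convert g.smul_mem (2/3) this using 1
    module
  have hNi : w2 x i - w2 y j ∈ g := by
    convert g.smul_mem 2 (g.add_mem hN1 hN3) using 1
    module
  have hNj : w2 x j + w2 y i ∈ g := by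
    have := hc.bk mz hNi
    rw [bk_sub, bk_w2 sz, bk_w2 sz, h.Tzx, h.Tzy, zi, zj] at this
    simp only [w2_zero_left, w2_smul_right, w2_neg_left] at this
    convert g.smul_mem (2/3) this using 1
    module
  have Ci := hc.bk hN hNi
  have Cj := hc.bk hN hNj
  have Nw : ∀ w, Perp x y z w → (w2 x p - w2 y k) w = -(⟪p, w⟫ • x) + ⟪k, w⟫ • y := by
    intro w hw
    simp only [LinearMap.sub_apply, w2_apply, hw.1, hw.2.1]; module
  have Niw : ∀ w, Perp x y z w → (w2 x i - w2 y j) w = -(⟪i, w⟫ • x) + ⟪j, w⟫ • y := by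
    intro w hw
    simp only [LinearMap.sub_apply, w2_apply, hw.1, hw.2.1]; module
  have Njw : ∀ w, Perp x y z w → (w2 x j + w2 y i) w = -(⟪j, w⟫ • x) - ⟪i, w⟫ • y := by
    intro w hw
    simp only [LinearMap.add_apply, w2_apply, hw.1, hw.2.1]; module
  have Nx : (w2 x p - w2 y k) x = p := by
    simp only [LinearMap.sub_apply, w2_apply, h.nx, hx0 hp.1, hx0 Hk.1, h.yx]; module
  have Ny : (w2 x p - w2 y k) y = -k := by
    simp only [LinearMap.sub_apply, w2_apply, h.ny, hy0 hp.1, hy0 Hk.1, h.xy]; module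
  have Nz : (w2 x p - w2 y k) z = 0 := by
    simp only [LinearMap.sub_apply, w2_apply, h.xz, hz0 hp.1, hz0 Hk.1, h.yz]; module
  have Nix : (w2 x i - w2 y j) x = i := by
    simp only [LinearMap.sub_apply, w2_apply, h.nx, hx0 Hi.1, hx0 Hj.1, h.yx]; module
  have Niy : (w2 x i - w2 y j) y = -j := by
    simp only [LinearMap.sub_apply, w2_apply, h.ny, hy0 Hi.1, hy0 Hj.1, h.xy]; module
  have Niz : (w2 x i - w2 y j) z = 0 := by
    simp only [LinearMap.sub_apply, w2_apply, h.xz, hz0 Hi.1, hz0 Hj.1, h.yz]; module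
  have Njx : (w2 x j + w2 y i) x = j := by
    simp only [LinearMap.add_apply, w2_apply, h.nx, hx0 Hi.1, hx0 Hj.1, h.yx]; module
  have Njy : (w2 x j + w2 y i) y = i := by
    simp only [LinearMap.add_apply, w2_apply, h.ny, hy0 Hi.1, hy0 Hj.1, h.xy]; module
  have Njz : (w2 x j + w2 y i) z = 0 := by
    simp only [LinearMap.add_apply, w2_apply, h.xz, hz0 Hi.1, hz0 Hj.1, h.yz]; module
  have Ciw : ∀ w, Perp x y z w → bk (w2 x p - w2 y k) (w2 x i - w2 y j) w =
      -(⟪i, w⟫ • p) - ⟪j, w⟫ • k + ⟪p, w⟫ • i + ⟪k, w⟫ • j := by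
    intro w hw
    rw [bk_apply, Nw w hw, Niw w hw]
    simp only [map_add, map_neg, map_smul, Nx, Ny, Nix, Niy]; module
  have Cjw : ∀ w, Perp x y z w → bk (w2 x p - w2 y k) (w2 x j + w2 y i) w =
      -(⟪j, w⟫ • p) + ⟪i, w⟫ • k + ⟪p, w⟫ • j - ⟪k, w⟫ • i := by
    intro w hw
    rw [bk_apply, Nw w hw, Njw w hw]
    simp only [map_add, map_sub, map_neg, map_smul, Nx, Ny, Njx, Njy]; module
  have kCi := h.kill _ Ci
    (by rw [bk_apply, Nix, Nx, Nw _ Hi.1, Niw _ hp.1, pi, ki, ip, jp]; simp)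
    (by rw [bk_apply, Niy, Ny, map_neg, map_neg, Nw _ Hj.1, Niw _ Hk.1, pj, kj, ik, jk]; simp)
    (by rw [bk_apply, Niz, Nz]; simp)
  have kCj := h.kill _ Cj
    (by rw [bk_apply, Njx, Nx, Nw _ Hj.1, Njw _ hp.1, pj, kj, ip, jp]; simp)
    (by rw [bk_apply, Njy, Ny, map_neg, Nw _ Hi.1, Njw _ Hk.1, pi, ki, ik, jk]; simp)
    (by rw [bk_apply, Njz, Nz]; simp)
  have hzp : ∀ ζ, Zer T x y z ζ → T ζ p = 0 := by
    intro ζ hζ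
    have Hw := h.zeta_half hc hζ hp
    have c1 := kCi ζ p
    have c2 := kCj ζ p
    have pw : ⟪p, T ζ p⟫ = 0 := (hc.skew _ (h.mem.1 ζ)).self p
    rw [Ciw ζ hζ.1, Ciw p hp.1, Ciw _ Hw.1, pw, h.half_zero hc hp hζ, h.half_zero hc Hi hζ,
      h.half_zero hc Hj hζ, h.half_zero hc Hk hζ, ip, jp, kp, ← hn] at c1
    rw [Cjw ζ hζ.1, Cjw p hp.1, Cjw _ Hw.1, pw, h.half_zero hc hp hζ, h.half_zero hc Hi hζ,
      h.half_zero hc Hj hζ, h.half_zero hc Hk hζ, ip, jp, kp, ← hn] at c2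
    simp only [zero_smul, neg_zero, sub_zero, add_zero, zero_add, map_zero, LinearMap.zero_apply,
      map_smul] at c1 c2
    have e1 : T ζ i = (2 : ℝ) • T x (T ζ p) := by
      rw [hi, map_smul, h.ix, hζ.2.1]; simp
    have e2 : T ζ j = (2 : ℝ) • T y (T ζ p) := by
      rw [hj, map_smul, h.iy, hζ.2.2.1]; simp
    rw [e1] at c1
    rw [e2] at c2
    set w := T ζ p with hw
    have c3 := congrArg (fun v => (2 : ℝ) • T x v) c1
    simp only [map_add, map_sub, map_neg, map_smul, xp, xk, xj, h.hxx hc Hw] at c3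
    have c4 : n • w = ⟪i, w⟫ • i - ⟪j, w⟫ • j - ⟪k, w⟫ • k := by
      calc n • w = -((2 : ℝ) • n • (2 : ℝ) • -((1/4 : ℝ) • w)) := by module
        _ = _ := by rw [← c3]; module
    have d1 : ⟪j, w⟫ = 0 := by
      have := congrArg (fun v => ⟪j, v⟫) c4
      simp only [inner_sub_right, real_inner_smul_right, ji, jj, jk] at this
      nlinarith
    have d2 : ⟪k, w⟫ = 0 := by
      have := congrArg (fun v => ⟪k, v⟫) c4
      simp only [inner_sub_right, real_inner_smul_right, ki, kj, kk] at this
      nlinarith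
    rw [d1, d2] at c4 c2
    have c5 : n • w = ⟪i, w⟫ • i := by rw [c4]; module
    have c6 := congrArg (T y) c5
    rw [map_smul, map_smul, yi] at c6
    have c7 : ⟪i, w⟫ • k = - (⟪i, w⟫ • k) := by
      calc ⟪i, w⟫ • k = n • (2 : ℝ) • T y w := by rw [← c2]; module
        _ = (2 : ℝ) • n • T y w := by module
        _ = _ := by rw [c6]; module
    have d3 : ⟪i, w⟫ = 0 := by
      have := congrArg (fun v => ⟪k, v⟫) c7
      simp only [inner_neg_right, real_inner_smul_right, kk] at this
      nlinarith
    rw [d3, zero_smul] at c5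
    exact (smul_eq_zero.1 c5).resolve_left npos.ne'
  have hTp : T p + (1/2 : ℝ) • (w2 x i + w2 y j + w2 z k) = 0 := by
    have hD : IsSkew (T p + (1/2 : ℝ) • (w2 x i + w2 y j + w2 z k)) := by
      intro u v
      simp only [LinearMap.add_apply, LinearMap.smul_apply, inner_add_left, inner_add_right,
        real_inner_smul_left, real_inner_smul_right, h.sk hc, w2_skew _ _ u v]
      ring
    have Dx : (T p + (1/2 : ℝ) • (w2 x i + w2 y j + w2 z k)) x = 0 := by
      simp only [LinearMap.add_apply, LinearMap.smul_apply, w2_apply, h.nx, h.yx, h.zx, hx0 Hi.1,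
        hx0 Hj.1, hx0 Hk.1, h.mem.anti p x, xp]
      module
    have Dy : (T p + (1/2 : ℝ) • (w2 x i + w2 y j + w2 z k)) y = 0 := by
      simp only [LinearMap.add_apply, LinearMap.smul_apply, w2_apply, h.ny, h.xy, h.zy, hy0 Hi.1,
        hy0 Hj.1, hy0 Hk.1, h.mem.anti p y, yp]
      module
    have Dz : (T p + (1/2 : ℝ) • (w2 x i + w2 y j + w2 z k)) z = 0 := by
      simp only [LinearMap.add_apply, LinearMap.smul_apply, w2_apply, h.nz, h.xz, h.yz, hz0 Hi.1,
        hz0 Hj.1, hz0 Hk.1, h.mem.anti p z, zp]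
      module
    have D0 : ∀ ζ, Zer T x y z ζ →
        (T p + (1/2 : ℝ) • (w2 x i + w2 y j + w2 z k)) ζ = 0 := by
      intro ζ hζ
      simp only [LinearMap.add_apply, LinearMap.smul_apply, w2_apply, hζ.1.1, hζ.1.2.1, hζ.1.2.2,
        h.half_zero hc Hi hζ, h.half_zero hc Hj hζ, h.half_zero hc Hk hζ, h.mem.anti p ζ, hzp ζ hζ]
      module
    refine h.block hc hD ?_ ?_ ?_ ?_ ?_ ?_ ?_ ?_
    · rw [Dx]; simp
    · rw [Dy]; simp
    · rw [Dz]; simp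
    · intro u hu; rw [Dx, Dy, Dz]; simp
    · intro u hu; rw [Dx, Dy, Dz]; simp
    · intro u v hu hv; rw [D0 v hv]; simp
    · intro u v hu hv; rw [D0 v hv]; simp
    · intro u v hu hv
      rw [real_inner_comm]
      simp only [LinearMap.add_apply, LinearMap.smul_apply, w2_apply, hv.1.1, hv.1.2.1, hv.1.2.2,
        inner_add_left, inner_sub_left, real_inner_smul_left, hu.1.1, hu.1.2.1, hu.1.2.2,
        h.hhh hc hp hv hu]
      ring
  have hfin : w2 z k ∈ g := by
    have h1 := g.add_mem hN1 (h.mem.1 p)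
    convert g.smul_mem (-2/3) h1 using 1
    rw [eq_neg_of_add_eq_zero_left hTp]; module
  refine h.lemR hc hirr Hk ?_ hfin
  intro hk0
  rw [hk0, inner_zero_left] at kk
  linarith

end CaseN

section CaseA
variable {g : Submodule ℝ (V →ₗ[ℝ] V)} {T : V →ₗ[ℝ] V →ₗ[ℝ] V} {x y z : V}

theorem Tri.hp_inner (h : Tri g T x y z) (hc : Ctx g) {u : V} (hu : Half T x y z u) (v : V) :
    ⟪u, hp T x y z v⟫ = ⟪u, v⟫ := by
  conv_rhs => rw [decomp T x y z v]
  simp only [inner_add_right, real_inner_smul_right, h.half_zero hc hu (h.zp_zero hc v)]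
  rw [real_inner_comm x u, real_inner_comm y u, real_inner_comm z u, hu.1.1, hu.1.2.1, hu.1.2.2]
  ring

theorem Tri.bk_inner (h : Tri g T x y z) (hc : Ctx g) (B : V →ₗ[ℝ] V) (u v : V) :
    ⟪u, bk (T z) B v⟫ = - ⟪T z u, B v⟫ - ⟪u, B (T z v)⟫ := by
  rw [bk_apply, inner_sub_right, h.sk hc]; ring

set_option maxHeartbeats 2000000 in
theorem Tri.caseA (h : Tri g T x y z) (hc : Ctx g) (hirr : Irr g) {A : V →ₗ[ℝ] V} (hA : A ∈ g)
    (h0 : hp T x y z (A x) + (2 : ℝ) • T z (hp T x y z (A y)) ≠ 0) : FullSo g := by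
  obtain ⟨p, hpd⟩ : ∃ p, p = hp T x y z (A x) + (2 : ℝ) • T z (hp T x y z (A y)) := ⟨_, rfl⟩
  rw [← hpd] at h0
  have Hp : Half T x y z p := by
    rw [hpd]; exact (h.hp_half hc _).add ((h.halfz hc (h.hp_half hc _)).smul 2)
  have ip : ∀ u, Half T x y z u → ⟪u, p⟫ = ⟪u, A x⟫ - 2 * ⟪T z u, A y⟫ := by
    intro u hu
    have e := h.sk hc z u (hp T x y z (A y))
    rw [h.hp_inner hc (h.halfz hc hu)] at e
    rw [hpd, inner_add_right, real_inner_smul_right, h.hp_inner hc hu, e]; ring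
  have ipz : ∀ u, Half T x y z u → ⟪u, T z p⟫ = - ⟪T z u, A x⟫ - 1/2 * ⟪u, A y⟫ := by
    intro u hu
    have e := h.sk hc z u p
    rw [ip _ (h.halfz hc hu), hu.2, inner_neg_left, real_inner_smul_left] at e
    linarith
  have sA := hc.skew A hA
  have sz := hc.skew _ (h.mem.1 z)
  have mz := h.mem.1 z
  have m1 := hc.bk mz hA
  have m3 := hc.bk mz (hc.bk mz m1)
  have m5 := hc.bk mz (hc.bk mz m3)
  have hE := g.add_mem (g.add_mem m5 (g.smul_mem (5/4) m3)) (g.smul_mem (1/4) m1)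
  have sE := hc.skew _ hE
  have key : (bk (T z) (bk (T z) (bk (T z) (bk (T z) (bk (T z) A)))) +
      (5/4 : ℝ) • bk (T z) (bk (T z) (bk (T z) A)) + (1/4 : ℝ) • bk (T z) A) -
      (15/8 : ℝ) • (w2 x ((2 : ℝ) • T z p) + w2 y p) = 0 := by
    have hD : IsSkew ((bk (T z) (bk (T z) (bk (T z) (bk (T z) (bk (T z) A)))) +
      (5/4 : ℝ) • bk (T z) (bk (T z) (bk (T z) A)) + (1/4 : ℝ) • bk (T z) A) -
      (15/8 : ℝ) • (w2 x ((2 : ℝ) • T z p) + w2 y p)) := by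
      intro u v
      rw [LinearMap.sub_apply, LinearMap.sub_apply, inner_sub_left, inner_sub_right, sE u v]
      simp only [LinearMap.add_apply, LinearMap.smul_apply, inner_add_left, inner_add_right,
        real_inner_smul_left, real_inner_smul_right, w2_skew _ _ u v]
      ring
    have hx0 : ∀ {u}, Perp x y z u → ⟪u, x⟫ = 0 := fun hu => by rw [real_inner_comm]; exact hu.1
    have hy0 : ∀ {u}, Perp x y z u → ⟪u, y⟫ = 0 := fun hu => by rw [real_inner_comm]; exact hu.2.1
    have hz0 : ∀ {u}, Perp x y z u → ⟪u, z⟫ = 0 := fun hu => by rw [real_inner_comm]; exact hu.2.2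
    have Hz := h.halfz hc Hp
    have c1 : ⟪y, A x⟫ = - ⟪x, A y⟫ := by rw [← sA, real_inner_comm]
    have c2 : ⟪z, A x⟫ = - ⟪x, A z⟫ := by rw [← sA, real_inner_comm]
    have c3 : ⟪z, A y⟫ = - ⟪y, A z⟫ := by rw [← sA, real_inner_comm]
    refine h.block hc hD ?_ ?_ ?_ ?_ ?_ ?_ ?_ ?_
    · simp only [LinearMap.sub_apply, LinearMap.add_apply, LinearMap.smul_apply, inner_sub_right,
        inner_add_right, real_inner_smul_right, h.bk_inner hc, h.Tzx, h.Tzy, h.mem.2, map_neg, map_smul,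
        map_zero, inner_neg_left, inner_neg_right, inner_zero_left, inner_zero_right, w2_apply,
        real_inner_smul_left, hx0 Hp.1, hx0 Hz.1, Hp.1.2.1, Hz.1.2.1, h.xy, h.yx, h.nx, h.ny,
        sA.self, c1, c2, c3]
      ring
    · simp only [LinearMap.sub_apply, LinearMap.add_apply, LinearMap.smul_apply, inner_sub_right,
        inner_add_right, real_inner_smul_right, h.bk_inner hc, h.Tzx, h.Tzy, h.mem.2, map_neg, map_smul,
        map_zero, inner_neg_left, inner_neg_right, inner_zero_left, inner_zero_right, w2_apply,
        real_inner_smul_left, hy0 Hp.1, hy0 Hz.1, Hp.1.2.2, Hz.1.2.2, h.xy, h.yx, h.nx, h.ny,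
        h.zx, h.zy, sA.self, c1, c2, c3]
      ring
    · simp only [LinearMap.sub_apply, LinearMap.add_apply, LinearMap.smul_apply, inner_sub_right,
        inner_add_right, real_inner_smul_right, h.bk_inner hc, h.Tzx, h.Tzy, h.mem.2, map_neg, map_smul,
        map_zero, inner_neg_left, inner_neg_right, inner_zero_left, inner_zero_right, w2_apply,
        real_inner_smul_left, hz0 Hp.1, hz0 Hz.1, Hp.1.1, Hz.1.1, h.xy, h.yx, h.nx, h.ny,
        h.xz, h.yz, sA.self, c1, c2, c3]
      ring
    · intro u hu
      refine ⟨?_, ?_, ?_⟩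
      all_goals
        simp only [LinearMap.sub_apply, LinearMap.add_apply, LinearMap.smul_apply, inner_sub_right,
          inner_add_right, real_inner_smul_right, h.bk_inner hc, h.Tzx, h.Tzy, h.mem.2, map_neg, map_smul,
          map_zero, inner_neg_left, inner_neg_right, inner_zero_left, inner_zero_right, w2_apply,
          real_inner_smul_left, hz0 Hp.1, hz0 Hz.1, hx0 Hp.1, hx0 Hz.1, hy0 Hp.1, hy0 Hz.1,
          hx0 hu.1, hy0 hu.1, h.zero_half hc Hp hu, h.zero_half hc Hz hu, hu.2.2.2,
          h.xy, h.yx, h.nx, h.ny, h.xz, h.yz]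
        ring
    · intro u hu
      refine ⟨?_, ?_, ?_⟩
      all_goals
        simp only [LinearMap.sub_apply, LinearMap.add_apply, LinearMap.smul_apply, inner_sub_right,
          inner_add_right, real_inner_smul_right, h.bk_inner hc, h.Tzx, h.Tzy, h.mem.2, map_neg, map_smul,
          map_zero, inner_neg_left, inner_neg_right, inner_zero_left, inner_zero_right, w2_apply,
          real_inner_smul_left, hz0 Hp.1, hz0 Hz.1, hx0 Hp.1, hx0 Hz.1, hy0 Hp.1, hy0 Hz.1,
          hx0 hu.1, hy0 hu.1, hu.2, ip u hu, ipz u hu,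
          h.xy, h.yx, h.nx, h.ny, h.xz, h.yz]
        ring
    · intro u v hu hv
      simp only [LinearMap.sub_apply, LinearMap.add_apply, LinearMap.smul_apply, inner_sub_right,
        inner_add_right, real_inner_smul_right, h.bk_inner hc, map_neg, map_smul,
        map_zero, inner_neg_left, inner_neg_right, inner_zero_left, inner_zero_right, w2_apply,
        real_inner_smul_left, hx0 hu.1, hy0 hu.1, hv.1.1, hv.1.2.1, hu.2.2.2, hv.2.2.2]
      ring
    · intro u v hu hv
      simp only [LinearMap.sub_apply, LinearMap.add_apply, LinearMap.smul_apply, inner_sub_right,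
        inner_add_right, real_inner_smul_right, h.bk_inner hc, map_neg, map_smul,
        map_zero, inner_neg_left, inner_neg_right, inner_zero_left, inner_zero_right, w2_apply,
        real_inner_smul_left, hx0 hu.1, hy0 hu.1, hv.1.1, hv.1.2.1, hu.2, hv.2.2.2]
      ring
    · intro u v hu hv
      simp only [LinearMap.sub_apply, LinearMap.add_apply, LinearMap.smul_apply, inner_sub_right,
        inner_add_right, real_inner_smul_right, h.bk_inner hc, map_neg, map_smul,
        map_zero, inner_neg_left, inner_neg_right, inner_zero_left, inner_zero_right, w2_apply,
        real_inner_smul_left, hx0 hu.1, hy0 hu.1, hv.1.1, hv.1.2.1, hu.2, hv.2]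
      ring
  rw [sub_eq_zero.1 key] at hE
  have hm := mem_of_smul_mem (by norm_num) hE
  refine h.caseN hc hirr (p := (2 : ℝ) • T z p) ((h.halfz hc Hp).smul 2) ?_ ?_
  · intro hz
    have : (2 : ℝ) • T z ((2 : ℝ) • T z p) = 0 := by rw [hz]; simp
    rw [map_smul, Hp.2] at this
    apply h0
    have e : p = -((2 : ℝ) • (2 : ℝ) • -((1/4 : ℝ) • p)) := by module
    rw [e, this, neg_zero]
  · convert hm using 1
    rw [map_smul, Hp.2, show (2 : ℝ) • (2 : ℝ) • -((1/4 : ℝ) • p) = -p by module, w2_neg_right]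
    abel

end CaseA

/-- The natural inner product on bilinear products. -/
def ip (σ τ : V →ₗ[ℝ] V →ₗ[ℝ] V) : ℝ :=
  ∑ i, ∑ j, ⟪σ (stdOrthonormalBasis ℝ V i) (stdOrthonormalBasis ℝ V j),
    τ (stdOrthonormalBasis ℝ V i) (stdOrthonormalBasis ℝ V j)⟫

/-- The derivation action of endomorphisms on products. -/
def act (A : V →ₗ[ℝ] V) (τ : V →ₗ[ℝ] V →ₗ[ℝ] V) : V →ₗ[ℝ] V →ₗ[ℝ] V :=
  τ.compr₂ A - τ ∘ₗ A - τ.compl₂ A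

theorem act_apply (A : V →ₗ[ℝ] V) (τ : V →ₗ[ℝ] V →ₗ[ℝ] V) (u v : V) :
    act A τ u v = A (τ u v) - τ (A u) v - τ u (A v) := by
  simp [act]

section IP
variable {g : Submodule ℝ (V →ₗ[ℝ] V)}

theorem InP.act (hc : Ctx g) {A : V →ₗ[ℝ] V} (hA : A ∈ g) {τ : V →ₗ[ℝ] V →ₗ[ℝ] V}
    (h : InP g τ) : InP g (act A τ) := by
  constructor
  · intro u
    have : _root_.act A τ u = bk A (τ u) - τ (A u) := by
      ext v
      rw [act_apply, LinearMap.sub_apply, bk_apply]; abel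
    rw [this]
    exact g.sub_mem (hc.bk hA (h.1 u)) (h.1 _)
  · intro u
    rw [act_apply, h.2, h.anti u (A u)]; simp

theorem ip_comm (σ τ : V →ₗ[ℝ] V →ₗ[ℝ] V) : ip σ τ = ip τ σ := by
  simp only [ip]
  exact Finset.sum_congr rfl fun i _ => Finset.sum_congr rfl fun j _ => real_inner_comm _ _
theorem ip_add_left (σ σ' τ : V →ₗ[ℝ] V →ₗ[ℝ] V) : ip (σ + σ') τ = ip σ τ + ip σ' τ := by
  simp only [ip, LinearMap.add_apply, inner_add_left, Finset.sum_add_distrib]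
theorem ip_smul_left (r : ℝ) (σ τ : V →ₗ[ℝ] V →ₗ[ℝ] V) : ip (r • σ) τ = r * ip σ τ := by
  simp only [ip, LinearMap.smul_apply, real_inner_smul_left, Finset.mul_sum]
theorem ip_add_right (σ τ τ' : V →ₗ[ℝ] V →ₗ[ℝ] V) : ip σ (τ + τ') = ip σ τ + ip σ τ' := by
  rw [ip_comm, ip_add_left, ip_comm τ, ip_comm τ']
theorem ip_smul_right (r : ℝ) (σ τ : V →ₗ[ℝ] V →ₗ[ℝ] V) : ip σ (r • τ) = r * ip σ τ := by
  rw [ip_comm, ip_smul_left, ip_comm]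
theorem ip_self_nonneg (σ : V →ₗ[ℝ] V →ₗ[ℝ] V) : 0 ≤ ip σ σ :=
  Finset.sum_nonneg fun i _ => Finset.sum_nonneg fun j _ => real_inner_self_nonneg
theorem ip_self_eq_zero {σ : V →ₗ[ℝ] V →ₗ[ℝ] V} (h : ip σ σ = 0) : σ = 0 := by
  have h1 := (Finset.sum_eq_zero_iff_of_nonneg (fun i _ =>
    Finset.sum_nonneg fun j _ => real_inner_self_nonneg)).1 h
  refine (stdOrthonormalBasis ℝ V).toBasis.ext fun i => ?_
  refine (stdOrthonormalBasis ℝ V).toBasis.ext fun j => ?_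
  have h2 := (Finset.sum_eq_zero_iff_of_nonneg (fun j _ =>
    real_inner_self_nonneg)).1 (h1 i (Finset.mem_univ _)) j (Finset.mem_univ _)
  simpa using inner_self_eq_zero.1 h2

theorem skew_sum {A : V →ₗ[ℝ] V} (hA : IsSkew A) (B : V →ₗ[ℝ] V →ₗ[ℝ] ℝ) :
    ∑ i, (B (A (stdOrthonormalBasis ℝ V i)) (stdOrthonormalBasis ℝ V i) +
      B (stdOrthonormalBasis ℝ V i) (A (stdOrthonormalBasis ℝ V i))) = 0 := by
  set e := stdOrthonormalBasis ℝ V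
  have hAe : ∀ i, A (e i) = ∑ k, ⟪e k, A (e i)⟫ • e k := fun i => (e.sum_repr' _).symm
  have h1 : ∀ i, B (A (e i)) (e i) = ∑ k, ⟪e k, A (e i)⟫ * B (e k) (e i) := by
    intro i
    conv_lhs => rw [hAe i]
    simp [map_sum]
  have h2 : ∀ i, B (e i) (A (e i)) = ∑ k, ⟪e k, A (e i)⟫ * B (e i) (e k) := by
    intro i
    conv_lhs => rw [hAe i]
    simp [map_sum]
  simp only [h1, h2, Finset.sum_add_distrib]
  rw [Finset.sum_comm, ← Finset.sum_add_distrib]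
  refine Finset.sum_eq_zero fun i _ => ?_
  rw [← Finset.sum_add_distrib]
  refine Finset.sum_eq_zero fun k _ => ?_
  have : ⟪e k, A (e i)⟫ = - ⟪e i, A (e k)⟫ := by rw [← hA, real_inner_comm]
  rw [this]; ring

theorem ip_act {A : V →ₗ[ℝ] V} (hA : IsSkew A) (σ τ : V →ₗ[ℝ] V →ₗ[ℝ] V) :
    ip (act A σ) τ = - ip σ (act A τ) := by
  set e := stdOrthonormalBasis ℝ V with he
  have h1 : ∑ j, ∑ i, (⟪σ (A (e i)) (e j), τ (e i) (e j)⟫ + ⟪σ (e i) (e j), τ (A (e i)) (e j)⟫)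
      = 0 := by
    refine Finset.sum_eq_zero fun j _ => ?_
    have := skew_sum hA ((innerₗ V).compl₁₂ (σ.flip (e j)) (τ.flip (e j)))
    simpa using this
  have h2 : ∑ i, ∑ j, (⟪σ (e i) (A (e j)), τ (e i) (e j)⟫ + ⟪σ (e i) (e j), τ (e i) (A (e j))⟫)
      = 0 := by
    refine Finset.sum_eq_zero fun i _ => ?_
    have := skew_sum hA ((innerₗ V).compl₁₂ (σ (e i)) (τ (e i)))
    simpa using this
  rw [Finset.sum_comm] at h1
  have h3 : ip (act A σ) τ + ip σ (act A τ) =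
      -(∑ i, ∑ j, (⟪σ (A (e i)) (e j), τ (e i) (e j)⟫ + ⟪σ (e i) (e j), τ (A (e i)) (e j)⟫)) -
      ∑ i, ∑ j, (⟪σ (e i) (A (e j)), τ (e i) (e j)⟫ + ⟪σ (e i) (e j), τ (e i) (A (e j))⟫) := by
    simp only [ip, ← Finset.sum_add_distrib, ← Finset.sum_neg_distrib, ← Finset.sum_sub_distrib]
    refine Finset.sum_congr rfl fun i _ => Finset.sum_congr rfl fun j _ => ?_
    simp only [act_apply, inner_sub_left, inner_sub_right, hA (σ _ _), ← he]
    ring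
  rw [h1, h2] at h3
  linarith

theorem ip_cs (σ τ : V →ₗ[ℝ] V →ₗ[ℝ] V) : (ip σ τ) ^ 2 ≤ ip σ σ * ip τ τ := by
  rcases (ip_self_nonneg τ).lt_or_eq with h | h
  · have h1 := ip_self_nonneg (ip τ τ • σ + (-(ip σ τ)) • τ)
    simp only [ip_add_left, ip_add_right, ip_smul_left, ip_smul_right, ip_comm τ σ] at h1
    have h2 : 0 ≤ ip τ τ * (ip σ σ * ip τ τ - (ip σ τ) ^ 2) := by nlinarith
    have := nonneg_of_mul_nonneg_right h2 h
    linarith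
  · have := ip_self_eq_zero h.symm
    subst this
    have h0 : ip σ 0 = 0 := by simp [ip]
    rw [h0]; simp [ip]

/-- maximal triple data -/
structure MT (g : Submodule ℝ (V →ₗ[ℝ] V)) (c : ℝ) (T : V →ₗ[ℝ] V →ₗ[ℝ] V) (x y z : V) :
    Prop where
  mem : InP g T
  nx : ⟪x, x⟫ = 1
  ny : ⟪y, y⟫ = 1
  nz : ⟪z, z⟫ = 1
  val : ⟪T x y, z⟫ = 1
  rep : ∀ S, InP g S → ip S T = c * ⟪S x y, z⟫

/-- the global bound -/
def Bd (g : Submodule ℝ (V →ₗ[ℝ] V)) (c : ℝ) : Prop :=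
  0 < c ∧ ∀ S, InP g S → ∀ a b d : V, c * ⟪S a b, d⟫ ^ 2 ≤ ip S S * (⟪a, a⟫ * ⟪b, b⟫ * ⟪d, d⟫)

theorem InP.sk (hc : Ctx g) {S : V →ₗ[ℝ] V →ₗ[ℝ] V} (h : InP g S) (u v w : V) :
    ⟪S u v, w⟫ = - ⟪v, S u w⟫ := hc.skew _ (h.1 u) v w

theorem InP.cyc (hc : Ctx g) {S : V →ₗ[ℝ] V →ₗ[ℝ] V} (h : InP g S) (u v w : V) :
    ⟪S v w, u⟫ = ⟪S u v, w⟫ := by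
  rw [h.sk hc v w u, h.anti v u, inner_neg_right, neg_neg, real_inner_comm]

variable {c : ℝ} {T : V →ₗ[ℝ] V →ₗ[ℝ] V} {x y z : V}

theorem MT.cyc (hc : Ctx g) (h : MT g c T x y z) : MT g c T y z x :=
  ⟨h.mem, h.ny, h.nz, h.nx, by rw [h.mem.cyc hc]; exact h.val,
    fun S hS => by rw [hS.cyc hc]; exact h.rep S hS⟩

theorem MT.bd (hb : Bd g c) (h : MT g c T x y z) (u v : V) :
    ⟪T u v, T u v⟫ ≤ ⟪u, u⟫ * ⟪v, v⟫ := by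
  have h1 := hb.2 T h.mem u v (T u v)
  rw [h.rep T h.mem, h.val, mul_one] at h1
  have h2 := le_of_mul_le_mul_left h1 hb.1
  rcases (real_inner_self_nonneg (x := T u v)).lt_or_eq with h3 | h3
  · rw [sq] at h2
    exact le_of_mul_le_mul_right h2 h3
  · rw [← h3]
    exact mul_nonneg real_inner_self_nonneg real_inner_self_nonneg

theorem MT.Txy (hb : Bd g c) (h : MT g c T x y z) : T x y = z := by
  have h1 := h.bd hb x y
  rw [h.nx, h.ny, mul_one] at h1
  have h2 : ⟪T x y - z, T x y - z⟫ ≤ 0 := by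
    rw [inner_sub_left, inner_sub_right, inner_sub_right, h.nz, real_inner_comm (T x y) z, h.val]
    linarith
  have h3 : ⟪T x y - z, T x y - z⟫ = 0 := le_antisymm h2 real_inner_self_nonneg
  exact sub_eq_zero.1 (inner_self_eq_zero.1 h3)

theorem MT.ip_act (hc : Ctx g) (h : MT g c T x y z) {A : V →ₗ[ℝ] V} (hA : A ∈ g)
    {S : V →ₗ[ℝ] V →ₗ[ℝ] V} (hS : InP g S) :
    ip S (act A T) = c * (⟪S (A x) y, z⟫ + ⟪S x (A y), z⟫ + ⟪S x y, A z⟫) := by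
  have h1 := _root_.ip_act (hc.skew A hA) S T
  rw [h.rep _ (hS.act hc hA), act_apply, inner_sub_left, inner_sub_left, hc.skew A hA] at h1
  linarith

theorem MT.inv (hc : Ctx g) (h : MT g c T x y z) {A : V →ₗ[ℝ] V} (hA : A ∈ g)
    (h0 : ∀ S, InP g S → ⟪S (A x) y, z⟫ + ⟪S x (A y), z⟫ + ⟪S x y, A z⟫ = 0) (u v : V) :
    A (T u v) = T (A u) v + T u (A v) := by
  have h1 : act A T = 0 := ip_self_eq_zero (by
    rw [h.ip_act hc hA (h.mem.act hc hA), h0 _ (h.mem.act hc hA), mul_zero])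
  have h2 : act A T u v = 0 := by rw [h1]; rfl
  rw [act_apply, sub_sub, sub_eq_zero] at h2
  exact h2

theorem MT.ix (hc : Ctx g) (hb : Bd g c) (h : MT g c T x y z) (u v : V) :
    T x (T u v) = T (T x u) v + T u (T x v) := by
  refine h.inv hc (h.mem.1 x) (fun S hS => ?_) u v
  have e : T x z = - y := by
    rw [h.mem.anti, (h.cyc hc |>.cyc hc).Txy hb]
  rw [h.mem.2, h.Txy hb, e, inner_neg_right, map_zero, LinearMap.zero_apply, inner_zero_left,
    real_inner_comm, (hc.skew _ (hS.1 x)).self, real_inner_comm, (hc.skew _ (hS.1 x)).self]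
  ring

theorem MT.tri (hc : Ctx g) (hb : Bd g c) (h : MT g c T x y z) : Tri g T x y z := by
  have h2 := h.cyc hc
  have h3 := h2.cyc hc
  refine ⟨h.mem, h.nx, h.ny, h.nz, ?_, ?_, ?_, h.Txy hb, h2.Txy hb, h3.Txy hb, h.ix hc hb,
    h2.ix hc hb, h3.ix hc hb, ?_, h.bd hb⟩
  · have := (hc.skew _ (h.mem.1 z)).self x; rwa [h3.Txy hb] at this
  · have := (hc.skew _ (h.mem.1 x)).self y; rwa [h.Txy hb] at this
  · have := (hc.skew _ (h.mem.1 y)).self z; rwa [h2.Txy hb] at this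
  · intro C hC c1 c2 c3
    exact h.inv hc hC (fun S hS => by rw [c1, c2, c3]; simp)

/-- the submodule of prolongation elements -/
def PS (g : Submodule ℝ (V →ₗ[ℝ] V)) : Submodule ℝ (V →ₗ[ℝ] V →ₗ[ℝ] V) where
  carrier := {τ | InP g τ}
  add_mem' := by
    rintro a b ⟨h1, h2⟩ ⟨h3, h4⟩
    exact ⟨fun u => g.add_mem (h1 u) (h3 u), fun u => by simp [h2, h4]⟩
  zero_mem' := ⟨fun u => g.zero_mem, fun u => rfl⟩
  smul_mem' := by
    rintro r a ⟨h1, h2⟩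
    exact ⟨fun u => g.smul_mem r (h1 u), fun u => by simp [h2]⟩

theorem InP.smul {S : V →ₗ[ℝ] V →ₗ[ℝ] V} (h : InP g S) (r : ℝ) : InP g (r • S) :=
  (PS g).smul_mem r h

theorem cont_bil (b : V →ₗ[ℝ] V →ₗ[ℝ] V) :
    Continuous fun q : V × V × V => ⟪b q.1 q.2.1, q.2.2⟫ := by
  have e : ∀ q : V × V × V, b q.1 q.2.1 =
      ∑ i, ⟪stdOrthonormalBasis ℝ V i, q.1⟫ • b (stdOrthonormalBasis ℝ V i) q.2.1 := by
    intro q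
    conv_lhs => rw [← (stdOrthonormalBasis ℝ V).sum_repr' q.1]
    simp [map_sum]
  simp only [e]
  have hb : ∀ i, Continuous (b (stdOrthonormalBasis ℝ V i)) := fun i =>
    LinearMap.continuous_of_finiteDimensional _
  refine Continuous.inner ?_ (by fun_prop)
  refine continuous_finsetSum _ fun i _ => ?_
  exact (Continuous.inner continuous_const continuous_fst).smul ((hb i).comp (by fun_prop))

theorem gen_riesz {E : Type} [AddCommGroup E] [Module ℝ E] [FiniteDimensional ℝ E]
    (L : E →ₗ[ℝ] E →ₗ[ℝ] ℝ) (hL : ∀ t, L t t = 0 → t = 0) (φ : E →ₗ[ℝ] ℝ) :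
    ∃ t : E, ∀ S : E, L t S = φ S := by
  have hinj : Function.Injective L := by
    refine (injective_iff_map_eq_zero L).2 fun t ht => hL t ?_
    rw [ht]; rfl
  have hs : Function.Surjective L :=
    (LinearMap.injective_iff_surjective_of_finrank_eq_finrank
      (Subspace.dual_finrank_eq (K := ℝ) (V := E)).symm).1 hinj
  obtain ⟨t, ht⟩ := hs φ
  exact ⟨t, fun S => by rw [← ht]⟩

/-- the inner product as a bilinear form -/
def ipL (g : Submodule ℝ (V →ₗ[ℝ] V)) : PS g →ₗ[ℝ] PS g →ₗ[ℝ] ℝ :=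
  LinearMap.mk₂ ℝ (fun t S => ip S.1 t.1)
    (fun a b d => ip_add_right _ _ _) (fun r a b => ip_smul_right _ _ _)
    (fun a b d => ip_add_left _ _ _) (fun r a b => ip_smul_left _ _ _)

theorem ipL_apply (g : Submodule ℝ (V →ₗ[ℝ] V)) (t S : PS g) : ipL g t S = ip S.1 t.1 := by
  rw [ipL, LinearMap.mk₂_apply]

theorem exists_riesz (g : Submodule ℝ (V →ₗ[ℝ] V)) (φ : PS g →ₗ[ℝ] ℝ) :
    ∃ t : PS g, ∀ S : PS g, ip S.1 t.1 = φ S := by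
  obtain ⟨t, ht⟩ := gen_riesz (E := PS g) (ipL g) (fun t ht => by
    rw [ipL_apply] at ht; exact Subtype.ext (ip_self_eq_zero ht)) φ
  exact ⟨t, fun S => by rw [← ht, ipL_apply]⟩

theorem exists_MT (hc : Ctx g) {S₀ : V →ₗ[ℝ] V →ₗ[ℝ] V} (h0 : InP g S₀) (hne : S₀ ≠ 0) :
    ∃ c T, ∃ x y z : V, Bd g c ∧ MT g c T x y z := by
  have hfd : FiniteDimensional ℝ (PS g) := inferInstance
  have hfr : Module.Free ℝ (PS g) := Module.Free.of_divisionRing ℝ (PS g)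
  let b := Module.finBasis ℝ (PS g)
  choose t ht using fun i => exists_riesz g (b.coord i)
  let R : V → V → V → (V →ₗ[ℝ] V →ₗ[ℝ] V) := fun x y z => ∑ i, ⟪(b i).1 x y, z⟫ • (t i).1
  have hR : ∀ x y z, InP g (R x y z) := fun x y z =>
    (PS g).sum_mem fun i _ => (PS g).smul_mem _ (t i).2
  have hrep : ∀ x y z S, InP g S → ip S (R x y z) = ⟪S x y, z⟫ := by
    intro x y z S hS
    have e1 : ip S (R x y z) = ∑ i, ⟪(b i).1 x y, z⟫ * b.repr ⟨S, hS⟩ i := by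
      simp only [R]
      have : ∀ (s : Finset (Fin (Module.finrank ℝ (PS g)))), ip S (∑ i ∈ s, ⟪(b i).1 x y, z⟫ •
          (t i).1) = ∑ i ∈ s, ⟪(b i).1 x y, z⟫ * b.repr ⟨S, hS⟩ i := by
        intro s
        induction s using Finset.induction_on with
        | empty => simp [ip]
        | insert i s his ih =>
          rw [Finset.sum_insert his, Finset.sum_insert his, ip_add_right, ip_smul_right, ih]
          have := ht i ⟨S, hS⟩
          simp only [Module.Basis.coord_apply] at this
          rw [this]
      exact this _
    have e2 : S = ∑ i, b.repr ⟨S, hS⟩ i • (b i).1 := by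
      have := congrArg Subtype.val (b.sum_repr ⟨S, hS⟩)
      rw [Submodule.coe_sum] at this
      exact this.symm
    rw [e1]
    conv_rhs => rw [e2]
    simp only [LinearMap.sum_apply, LinearMap.smul_apply, sum_inner, real_inner_smul_left]
    exact Finset.sum_congr rfl fun i _ => mul_comm _ _
  let f : V × V × V → ℝ := fun q => ⟪R q.1 q.2.1 q.2.2 q.1 q.2.1, q.2.2⟫
  have hf : Continuous f := by
    have : f = fun q => ∑ i, ⟪(b i).1 q.1 q.2.1, q.2.2⟫ * ⟪(t i).1 q.1 q.2.1, q.2.2⟫ := by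
      funext q
      simp only [f, R, LinearMap.sum_apply, LinearMap.smul_apply, sum_inner, real_inner_smul_left]
    rw [this]
    exact continuous_finsetSum _ fun i _ => (cont_bil _).mul (cont_bil _)
  have hfip : ∀ x y z, f (x, y, z) = ip (R x y z) (R x y z) := fun x y z =>
    (hrep x y z _ (hR x y z)).symm
  obtain ⟨a0, b0, d0, hS0⟩ : ∃ a b d : V, ⟪S₀ a b, d⟫ ≠ 0 := by
    by_contra hcon
    push Not at hcon
    apply hne
    ext u v
    exact inner_self_eq_zero.1 (hcon u v _)
  have ha0 : a0 ≠ 0 := fun h => hS0 (by simp [h])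
  have : Nontrivial V := ⟨a0, 0, ha0⟩
  let K : Set (V × V × V) := Metric.sphere (0 : V) 1 ×ˢ Metric.sphere (0 : V) 1 ×ˢ
    Metric.sphere (0 : V) 1
  have hK : IsCompact K := (isCompact_sphere _ _).prod ((isCompact_sphere _ _).prod
    (isCompact_sphere _ _))
  have hKne : K.Nonempty := by
    obtain ⟨s, hs⟩ := (NormedSpace.sphere_nonempty (E := V) (x := 0) (r := 1)).2 zero_le_one
    exact ⟨(s, s, s), hs, hs, hs⟩
  obtain ⟨⟨x, y, z⟩, hxyz, hmax⟩ := hK.exists_isMaxOn hKne hf.continuousOn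
  obtain ⟨hx, hy, hz⟩ := hxyz
  simp only [mem_sphere_zero_iff_norm] at hx hy hz
  set M := f (x, y, z) with hM
  -- scaling
  have hbound : ∀ S, InP g S → ∀ a b d : V,
      ⟪S a b, d⟫ ^ 2 ≤ ip S S * M * (⟪a, a⟫ * ⟪b, b⟫ * ⟪d, d⟫) := by
    intro S hS a b d
    by_cases ha : a = 0
    · simp [ha]
    by_cases hb : b = 0
    · simp [hb]
    by_cases hd : d = 0
    · simp [hd]
    have unit : ∀ v : V, v ≠ 0 → ‖(‖v‖⁻¹ : ℝ) • v‖ = 1 := fun v hv => by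
      rw [norm_smul, norm_inv, norm_norm, inv_mul_cancel₀ (norm_ne_zero_iff.2 hv)]
    have un2 : ∀ v : V, v ≠ 0 → v = ‖v‖ • ((‖v‖⁻¹ : ℝ) • v) := fun v hv => by
      rw [smul_smul, mul_inv_cancel₀ (norm_ne_zero_iff.2 hv), one_smul]
    have hle : f ((‖a‖⁻¹ : ℝ) • a, (‖b‖⁻¹ : ℝ) • b, (‖d‖⁻¹ : ℝ) • d) ≤ M :=
      hmax ⟨by simpa using unit a ha, by simpa using unit b hb, by simpa using unit d hd⟩
    rw [hfip] at hle
    have hcs := ip_cs S (R ((‖a‖⁻¹ : ℝ) • a) ((‖b‖⁻¹ : ℝ) • b) ((‖d‖⁻¹ : ℝ) • d))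
    rw [hrep _ _ _ S hS] at hcs
    have h1 : ⟪S ((‖a‖⁻¹ : ℝ) • a) ((‖b‖⁻¹ : ℝ) • b), (‖d‖⁻¹ : ℝ) • d⟫ ^ 2 ≤ ip S S * M :=
      hcs.trans (mul_le_mul_of_nonneg_left hle (ip_self_nonneg S))
    have h2 : ⟪S a b, d⟫ = ‖a‖ * ‖b‖ * ‖d‖ *
        ⟪S ((‖a‖⁻¹ : ℝ) • a) ((‖b‖⁻¹ : ℝ) • b), (‖d‖⁻¹ : ℝ) • d⟫ := by
      conv_lhs => rw [un2 a ha, un2 b hb, un2 d hd]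
      rw [map_smul S ‖a‖, LinearMap.smul_apply, map_smul _ ‖b‖, real_inner_smul_left,
        real_inner_smul_left, real_inner_smul_right _ _ ‖d‖]
      ring
    rw [h2, mul_pow, real_inner_self_eq_norm_sq, real_inner_self_eq_norm_sq,
      real_inner_self_eq_norm_sq]
    calc (‖a‖ * ‖b‖ * ‖d‖) ^ 2 * _ ≤ (‖a‖ * ‖b‖ * ‖d‖) ^ 2 * (ip S S * M) :=
          mul_le_mul_of_nonneg_left h1 (sq_nonneg _)
      _ = _ := by ring
  have hM0 : 0 ≤ M := by rw [hM, hfip]; exact ip_self_nonneg _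
  have hMpos : 0 < M := by
    rcases hM0.lt_or_eq with h | h
    · exact h
    · have := hbound S₀ h0 a0 b0 d0
      rw [← h, mul_zero, zero_mul] at this
      have h2 := (sq_nonneg ⟪S₀ a0 b0, d0⟫).antisymm' this
      exact absurd (pow_eq_zero_iff (two_ne_zero) |>.1 h2) hS0
  refine ⟨M⁻¹, M⁻¹ • R x y z, x, y, z, ⟨inv_pos.2 hMpos, ?_⟩, ⟨(hR x y z).smul _, ?_, ?_, ?_, ?_,
    ?_⟩⟩
  · intro S hS a b d
    rw [inv_mul_le_iff₀ hMpos]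
    have := hbound S hS a b d
    nlinarith
  · rw [real_inner_self_eq_norm_sq, hx]; norm_num
  · rw [real_inner_self_eq_norm_sq, hy]; norm_num
  · rw [real_inner_self_eq_norm_sq, hz]; norm_num
  · rw [LinearMap.smul_apply, LinearMap.smul_apply, real_inner_smul_left]
    exact inv_mul_cancel₀ hMpos.ne'
  · intro S hS
    rw [ip_smul_right, hrep x y z S hS]

end IP

section Step5
variable {g : Submodule ℝ (V →ₗ[ℝ] V)} {T : V →ₗ[ℝ] V →ₗ[ℝ] V} {x y z : V} {c : ℝ}

theorem Tri.zer_of_perp (h : Tri g T x y z) (hc : Ctx g) {u : V} (hu : Perp x y z u)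
    (hh : ∀ v, Half T x y z v → ⟪v, u⟫ = 0) : Zer T x y z u := by
  have h1 : hp T x y z u = 0 := by
    refine inner_self_eq_zero (𝕜 := ℝ).1 ?_
    rw [h.hp_inner hc (h.hp_half hc u)]
    exact hh _ (h.hp_half hc u)
  have h2 := decomp T x y z u
  rw [hu.1, hu.2.1, hu.2.2, h1] at h2
  have h3 : u = zp T x y z u := by simpa using h2
  rw [h3]
  exact h.zp_zero hc u

theorem Tri.pz (h : Tri g T x y z) (hc : Ctx g) (hirr : Irr g) (hnf : ¬ FullSo g)
    {A : V →ₗ[ℝ] V} (hA : A ∈ g) {u : V} (hu : Half T x y z u) :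
    ⟪u, A x⟫ = 2 * ⟪T z u, A y⟫ := by
  have h0 : hp T x y z (A x) + (2 : ℝ) • T z (hp T x y z (A y)) = 0 := by
    by_contra hne
    exact hnf (h.caseA hc hirr hA hne)
  have h1 : ⟪u, hp T x y z (A x) + (2 : ℝ) • T z (hp T x y z (A y))⟫ = 0 := by
    rw [h0, inner_zero_right]
  have h2 := h.sk hc z u (hp T x y z (A y))
  rw [inner_add_right, real_inner_smul_right, h.hp_inner hc hu] at h1
  rw [h.hp_inner hc (h.halfz hc hu)] at h2
  linarith

theorem Tri.kap (h : Tri g T x y z) (hc : Ctx g) (hirr : Irr g) (hnf : ¬ FullSo g)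
    {A : V →ₗ[ℝ] V} (hA : A ∈ g) : Zer T x y z (act A T y z) := by
  have hS : InP g (act A T) := h.mem.act hc hA
  have e : act A T y z = A x + T z (A y) - T y (A z) := by
    rw [act_apply, h.Tyz, h.mem.anti (A y) z]; abel
  refine h.zer_of_perp hc ⟨?_, ?_, ?_⟩ ?_
  · rw [e, inner_sub_right, inner_add_right]
    have h1 := (hc.skew A hA).self x
    have h2 := h.sk hc z x (A y)
    have h3 := h.sk hc y x (A z)
    rw [h.Tzx, (hc.skew A hA).self y] at h2
    rw [h.Tyx, inner_neg_left, (hc.skew A hA).self z] at h3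
    linarith
  · exact (hc.skew _ (hS.1 y)).self z |> fun _ => by
      have := hS.sk hc y y z
      rw [hS.2, inner_zero_left] at this
      linarith
  · exact (hc.skew _ (hS.1 y)).self z
  · intro u hu
    have hu2 := h.cyc.half_cyc hc (h.half_cyc hc hu)
    have a1 := h.pz hc hirr hnf hA hu
    have a2 := h.cyc.cyc.pz hc hirr hnf hA (h.cyc.cyc.halfz hc hu2)
    rw [h.hyy hc hu, inner_neg_left, real_inner_smul_left] at a2
    have a3 := h.sk hc z u (A y)
    have a4 := h.sk hc y u (A z)
    rw [e, inner_sub_right, inner_add_right]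
    linarith

theorem Tri.caseb1 (h : Tri g T x y z) (hc : Ctx g) (hirr : Irr g) (hnf : ¬ FullSo g)
    {A : V →ₗ[ℝ] V} (hA : A ∈ g) (hne : act A T y z ≠ 0) :
    ∃ A' ∈ g, ∃ η, A' x = η ∧ A' y = 0 ∧ A' z = 0 ∧ ⟪η, η⟫ = 1 ∧ Zer T x y z η := by
  have hS : InP g (act A T) := h.mem.act hc hA
  have k1 := h.kap hc hirr hnf hA
  have k2 := (h.cyc.kap hc hirr hnf hA).cyc.cyc
  set S := act A T with hSd
  set κ := S y z with hκ
  let B := S z + bk (T y) (bk (T y) (S z))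
  have Szy : S z y = - κ := hS.anti z y
  have Szz : S z z = 0 := hS.2 z
  have Bx : B x = 0 := by
    simp only [B, LinearMap.add_apply, bk_apply, h.Tyx, map_neg, map_sub, h.Tyz, Szz, k2.2.2.1,
      map_zero]
    simp
  have By : B y = - κ := by
    simp only [B, LinearMap.add_apply, bk_apply, h.mem.2 y, Szy, map_neg, map_sub, k1.2.2.1,
      map_zero]
    simp
  have Bz : B z = 0 := by
    simp only [B, LinearMap.add_apply, bk_apply, h.Tyx, map_neg, map_sub, h.Tyz, Szz, k2.2.2.1,
      map_zero]
    simp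
  have hB : B ∈ g := g.add_mem (hS.1 z) (hc.bk (h.mem.1 y) (hc.bk (h.mem.1 y) (hS.1 z)))
  have hpos := inner_pos_of_ne hne
  have hn : ‖κ‖ ≠ 0 := norm_ne_zero_iff.2 hne
  have C1 : bk (T z) B x = κ := by rw [bk_apply, Bx, h.Tzx, By]; simp
  have C2 : bk (T z) B y = 0 := by
    rw [bk_apply, By, h.Tzy, map_neg, map_neg, Bx, k1.2.2.2]; simp
  have C3 : bk (T z) B z = 0 := by rw [bk_apply, Bz, h.mem.2]; simp
  refine ⟨‖κ‖⁻¹ • bk (T z) B, g.smul_mem _ (hc.bk (h.mem.1 z) hB), ‖κ‖⁻¹ • κ, ?_, ?_, ?_, ?_, ?_⟩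
  · rw [LinearMap.smul_apply, C1]
  · rw [LinearMap.smul_apply, C2, smul_zero]
  · rw [LinearMap.smul_apply, C3, smul_zero]
  · rw [real_inner_smul_left, real_inner_smul_right, real_inner_self_eq_norm_sq]
    field_simp
  · exact ⟨k1.1.smul _, by rw [map_smul, k1.2.1, smul_zero], by rw [map_smul, k1.2.2.1, smul_zero],
      by rw [map_smul, k1.2.2.2, smul_zero]⟩

set_option maxHeartbeats 2000000 in
theorem MT.caseb (h0 : MT g c T x y z) (hb : Bd g c) (hc : Ctx g) (hirr : Irr g)
    {A : V →ₗ[ℝ] V} (hA : A ∈ g) {η : V} (Ax : A x = η) (Ay : A y = 0) (Az : A z = 0)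
    (nη : ⟪η, η⟫ = 1) (hη : Zer T x y z η) : FullSo g := by
  by_contra hnf
  have h := h0.tri hc hb
  have hS : InP g (act A T) := h.mem.act hc hA
  have Syz : act A T y z = η := by rw [act_apply, h.Tyz, Ax, Ay, Az]; simp
  have Szx : act A T z x = 0 := by rw [act_apply, h.Tzx, Ax, Ay, Az, hη.2.2.2]; simp
  have Sxy : act A T x y = 0 := by
    rw [act_apply, h.Txy, Ax, Ay, Az, h.mem.anti η y, hη.2.2.1]; simp
  have m : MT g c (act A T) y z η := by
    refine ⟨hS, h.ny, h.nz, nη, by rw [Syz]; exact nη, fun S' hS' => ?_⟩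
    rw [h0.ip_act hc hA hS', Ax, Ay, Az, hS'.cyc hc η y z]
    simp
  have s := m.tri hc hb
  set S := act A T with hSd
  have hPx : Perp η y z x := ⟨by rw [real_inner_comm]; exact hη.1.1, h.yx, h.zx⟩
  obtain ⟨Sηx, Syx⟩ := s.cyc.cyc.zero_vec hc hPx Szx
  -- the difference C
  obtain ⟨C, hC⟩ : ∃ C, C = S η - T x := ⟨_, rfl⟩
  have Cg : C ∈ g := by rw [hC]; exact g.sub_mem (hS.1 η) (h.mem.1 x)
  have Cx : C x = 0 := by rw [hC, LinearMap.sub_apply, Sηx, h.mem.2]; simp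
  have Cy : C y = 0 := by rw [hC, LinearMap.sub_apply, s.Tzx, h.Txy]; simp
  have Cz : C z = 0 := by rw [hC, LinearMap.sub_apply, s.Tzy, h.Txz]; simp
  have Cη : C η = 0 := by rw [hC, LinearMap.sub_apply, hS.2, hη.2.1]; simp
  have kT := h.kill C Cg Cx Cy Cz
  have kS := s.kill C Cg Cy Cz Cη
  have CTx : ∀ v, C (T x v) = T x (C v) := fun v => by rw [kT, Cx]; simp
  have CTy : ∀ v, C (T y v) = T y (C v) := fun v => by rw [kT, Cy]; simp
  have CTz : ∀ v, C (T z v) = T z (C v) := fun v => by rw [kT, Cz]; simp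
  have CSy : ∀ v, C (S y v) = S y (C v) := fun v => by rw [kS, Cy]; simp
  have CSη : ∀ v, C (S η v) = S η (C v) := fun v => by rw [kS, Cη]; simp
  have hSη : ∀ v, S η v = T x v + C v := fun v => by rw [hC, LinearMap.sub_apply]; abel
  have Cs := hc.skew C Cg
  have Chalf : ∀ v, Half T x y z v → Half T x y z (C v) := by
    intro v hv
    refine ⟨⟨?_, ?_, ?_⟩, by rw [← CTz, ← CTz, hv.2, map_neg, map_smul]⟩
    · exact Cs.flip (by rw [Cx, inner_zero_right])
    · exact Cs.flip (by rw [Cy, inner_zero_right])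
    · exact Cs.flip (by rw [Cz, inner_zero_right])
  have hperp : ∀ v, Half T x y z v → Perp y z η v := fun v hv =>
    ⟨hv.1.2.1, hv.1.2.2, h.zero_half hc hv hη⟩
  have E : ∀ v, Half T x y z v →
      -((1/2 : ℝ) • C v) + (3 : ℝ) • C (C (T x v)) + C (C (C v)) = 0 := by
    intro v hv
    have cub := s.cubic' hc (hperp v hv)
    have h1 := h.hxx hc hv
    have h2 := h.hxx hc (Chalf _ hv)
    simp only [hSη, map_add, CTx, h1, h2, map_neg, map_smul] at cub
    simp only [CTx]
    have := sub_eq_zero.2 cub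
    rw [← this]
    module
  have C2 : ∀ v, Half T x y z v → C (C (T z v)) = 0 := by
    intro v hv
    have e1 := E _ (h.halfy hc hv)
    have e2 := congrArg (T y) (E _ hv)
    rw [h.hxy hc hv] at e1
    simp only [map_add, map_neg, map_smul, ← CTy, map_zero, h.hyx hc hv] at e1 e2
    have e3 := congrArg₂ (· - ·) e1 e2
    simp only [sub_zero] at e3
    have : (3 : ℝ) • C (C (T z v)) = 0 := by rw [← e3]; module
    exact (smul_eq_zero.1 this).resolve_left (by norm_num)
  have C0 : ∀ v, Half T x y z v → C v = 0 := by
    intro v hv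
    have h1 := C2 _ (h.halfz hc hv)
    rw [hv.2] at h1
    simp only [map_neg, map_smul, neg_eq_zero] at h1
    have h2 := (smul_eq_zero.1 h1).resolve_left (by norm_num)
    have h3 := Cs v (C v)
    rw [h2, inner_zero_right, neg_zero, real_inner_comm] at h3
    exact inner_self_eq_zero.1 (by rw [real_inner_comm]; exact h3)
  have hST : ∀ v, Half T x y z v → Half S y z η v := by
    intro v hv
    refine ⟨hperp v hv, ?_⟩
    rw [hSη v, C0 v hv, add_zero, hSη, C0 _ (h.halfx hc hv), add_zero, h.hxx hc hv]
  have hSyH : ∀ v, Half T x y z v → Half T x y z (S y v) := by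
    intro v hv
    have hv' := hST v hv
    have q : Half T y z x (S y v) := by
      refine ⟨⟨?_, ?_, ?_⟩, ?_⟩
      · exact (s.perpx hc hv'.1).1
      · exact (s.perpx hc hv'.1).2.1
      · exact (hc.skew _ (hS.1 y)).flip (by rw [Syx, inner_zero_right])
      · have a1 : T x (S y v) = S η (S y v) := by rw [hSη, CSy, C0 v hv]; simp
        have a2 : T x (S η (S y v)) = S η (S η (S y v)) := by
          rw [hSη (S η (S y v)), CSη, CSy, C0 v hv]; simp
        rw [a1, a2, (s.halfx hc hv').2]
    exact h.cyc.cyc.half_cyc hc (h.cyc.half_cyc hc q)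
  -- the map `S x`
  have Sxz : S x z = 0 := by rw [hS.anti, Szx, neg_zero]
  have Sxs := hc.skew _ (hS.1 x)
  have kx := h.kill (S x) (hS.1 x) (hS.2 x) Sxy Sxz
  have Sxc : ∀ v, S x (T z v) = T z (S x v) := fun v => by rw [kx, Sxz]; simp
  have hSxH : ∀ v, Half T x y z v → Half T x y z (S x v) := by
    intro v hv
    refine ⟨⟨?_, ?_, ?_⟩, by rw [← Sxc, ← Sxc, hv.2, map_neg, map_smul]⟩
    · exact Sxs.flip (by rw [hS.2 x, inner_zero_right])
    · exact Sxs.flip (by rw [Sxy, inner_zero_right])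
    · exact Sxs.flip (by rw [Sxz, inner_zero_right])
  have key : ∀ v, Half T x y z v → S x v = -((2 : ℝ) • T z (S y v)) := by
    intro v hv
    have hh : Half T x y z (S x v + (2 : ℝ) • T z (S y v)) :=
      (hSxH v hv).add ((h.halfz hc (hSyH v hv)).smul 2)
    have := h.pz hc hirr hnf (hS.1 v) hh
    rw [hS.anti v x, hS.anti v y, inner_neg_right, inner_neg_right, h.sk hc z] at this
    refine eq_neg_of_add_eq_zero_left (inner_self_eq_zero (𝕜 := ℝ).1 ?_)
    rw [inner_add_right, real_inner_smul_right]
    linarith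
  refine hnf (h.no_half hc hirr fun v hv => ?_)
  have f1 : S x (S x v) = (1/4 : ℝ) • v := by
    rw [key v hv, map_neg, map_smul, Sxc, key _ (hSyH v hv), s.hxx hc (hST v hv)]
    simp only [map_neg, map_smul, hv.2]
    module
  have f2 := Sxs (S x v) v
  rw [f1, real_inner_smul_left] at f2
  have f3 := real_inner_self_nonneg (x := S x v)
  have f4 := real_inner_self_nonneg (x := v)
  exact inner_self_eq_zero (𝕜 := ℝ).1 (by linarith)

theorem MT.invariant (h0 : MT g c T x y z) (hb : Bd g c) (hc : Ctx g) (hirr : Irr g)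
    (hnf : ¬ FullSo g) {A : V →ₗ[ℝ] V} (hA : A ∈ g) : act A T = 0 := by
  have h := h0.tri hc hb
  have hS : InP g (act A T) := h.mem.act hc hA
  have aux : ∀ x y z, MT g c T x y z → act A T y z = 0 := by
    intro x y z m
    by_contra hne
    obtain ⟨A', hA', η, e1, e2, e3, e4, e5⟩ := (m.tri hc hb).caseb1 hc hirr hnf hA hne
    exact hnf (m.caseb hb hc hirr hA' e1 e2 e3 e4 e5)
  have k1 := aux _ _ _ h0
  have k2 := aux _ _ _ (h0.cyc hc)
  have k3 := aux _ _ _ ((h0.cyc hc).cyc hc)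
  apply ip_self_eq_zero
  rw [h0.ip_act hc hA hS, ← hS.cyc hc (A x), ← hS.cyc hc x (A y), ← hS.cyc hc (A y), k1, k2, k3]
  simp

end Step5

theorem vec_self_neg {v : V} (h : v = - v) : v = 0 := by
  have h2 : (2 : ℝ) • v = 0 := by
    rw [two_smul]; exact add_eq_zero_iff_eq_neg.2 h
  exact (smul_eq_zero.1 h2).resolve_left two_ne_zero

section Step6
variable {g : Submodule ℝ (V →ₗ[ℝ] V)} {T : V →ₗ[ℝ] V →ₗ[ℝ] V}

/-- invariant product in the prolongation -/
structure GInv (g : Submodule ℝ (V →ₗ[ℝ] V)) (T : V →ₗ[ℝ] V →ₗ[ℝ] V) : Prop where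
  mem : InP g T
  ne : T ≠ 0
  inv : ∀ A ∈ g, ∀ u v, A (T u v) = T (A u) v + T u (A v)

theorem GInv.center (h : GInv g T) (hirr : Irr g) {X : V} (hX : T X = 0) : X = 0 := by
  rcases hirr (LinearMap.ker T) (fun A hA X hX => by
    rw [LinearMap.mem_ker] at hX ⊢
    ext v
    have := h.inv A hA X v
    rw [hX] at this
    simpa using this.symm) with h1 | h1
  · have : X ∈ LinearMap.ker T := hX
    rw [h1] at this
    simpa using this
  · exact absurd (LinearMap.ker_eq_top.1 h1) h.ne

theorem GInv.center' (h : GInv g T) (hirr : Irr g) {X : V} (hX : ∀ Y, T Y X = 0) : X = 0 :=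
  h.center hirr (by ext v; rw [h.mem.anti, hX]; simp)

theorem skew_trace {A : V →ₗ[ℝ] V} (hA : IsSkew A) :
    LinearMap.trace ℝ V (A ∘ₗ A) = - ∑ i, ⟪A (stdOrthonormalBasis ℝ V i),
      A (stdOrthonormalBasis ℝ V i)⟫ := by
  rw [LinearMap.trace_eq_sum_inner _ (stdOrthonormalBasis ℝ V), ← Finset.sum_neg_distrib]
  refine Finset.sum_congr rfl fun i _ => ?_
  rw [hA, neg_neg, LinearMap.comp_apply]

theorem skew_trace_nonpos {A : V →ₗ[ℝ] V} (hA : IsSkew A) :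
    LinearMap.trace ℝ V (A ∘ₗ A) ≤ 0 := by
  rw [skew_trace hA]
  have : 0 ≤ ∑ i, ⟪A (stdOrthonormalBasis ℝ V i), A (stdOrthonormalBasis ℝ V i)⟫ :=
    Finset.sum_nonneg fun i _ => real_inner_self_nonneg
  linarith

theorem skew_trace_zero {A : V →ₗ[ℝ] V} (hA : IsSkew A)
    (h : LinearMap.trace ℝ V (A ∘ₗ A) = 0) : A = 0 := by
  rw [skew_trace hA, neg_eq_zero] at h
  have h1 := (Finset.sum_eq_zero_iff_of_nonneg (fun i _ => real_inner_self_nonneg)).1 h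
  refine (stdOrthonormalBasis ℝ V).toBasis.ext fun i => ?_
  simpa using inner_self_eq_zero.1 (h1 i (Finset.mem_univ _))

/-- the Killing form -/
def kil (T : V →ₗ[ℝ] V →ₗ[ℝ] V) : V →ₗ[ℝ] V →ₗ[ℝ] ℝ :=
  LinearMap.mk₂ ℝ (fun X Y => LinearMap.trace ℝ V (T X ∘ₗ T Y))
    (fun a b d => by rw [map_add, LinearMap.add_comp, map_add])
    (fun r a b => by rw [map_smul, LinearMap.smul_comp, map_smul])
    (fun a b d => by rw [map_add, LinearMap.comp_add, map_add])
    (fun r a b => by rw [map_smul, LinearMap.comp_smul, map_smul])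

/-- pairing with an endomorphism -/
def kilA (A : V →ₗ[ℝ] V) (T : V →ₗ[ℝ] V →ₗ[ℝ] V) : V →ₗ[ℝ] ℝ where
  toFun Y := LinearMap.trace ℝ V (A ∘ₗ T Y)
  map_add' a b := by rw [map_add, LinearMap.comp_add, map_add]
  map_smul' r a := by rw [map_smul, LinearMap.comp_smul, map_smul]; rfl

theorem GInv.bk (h : GInv g T) {A : V →ₗ[ℝ] V} (hA : A ∈ g) (Y : V) : bk A (T Y) = T (A Y) := by
  ext v
  rw [bk_apply, h.inv A hA]; abel

theorem GInv.surj (h : GInv g T) (hc : Ctx g) (hirr : Irr g) {A : V →ₗ[ℝ] V} (hA : A ∈ g) :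
    ∃ X, A = T X := by
  obtain ⟨X, hX⟩ := gen_riesz (E := V) (kil T) (fun t ht =>
    h.center hirr (skew_trace_zero (hc.skew _ (h.mem.1 t)) ht)) (kilA A T)
  refine ⟨X, ?_⟩
  have hX' : ∀ Y, LinearMap.trace ℝ V (T X ∘ₗ T Y) = LinearMap.trace ℝ V (A ∘ₗ T Y) := hX
  set D := A - T X with hD
  have Dg : D ∈ g := g.sub_mem hA (h.mem.1 X)
  have hD0 : ∀ Y, LinearMap.trace ℝ V (D ∘ₗ T Y) = 0 := fun Y => by
    rw [hD, LinearMap.sub_comp, map_sub, hX', sub_self]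
  have key : ∀ Y, D Y = 0 := by
    intro Y
    refine h.center hirr (skew_trace_zero (hc.skew _ (h.mem.1 _)) ?_)
    set Z := D Y with hZ
    have e1 : T Z = D ∘ₗ T Y - T Y ∘ₗ D := (h.bk Dg Y).symm
    have e2 := hD0 (T Y Z)
    rw [← h.bk (h.mem.1 Y) Z, _root_.bk, LinearMap.comp_sub, map_sub] at e2
    nth_rewrite 1 [e1]
    rw [LinearMap.sub_comp, map_sub, LinearMap.comp_assoc, LinearMap.comp_assoc,
      LinearMap.trace_comp_comm' (D ∘ₗ T Z), LinearMap.comp_assoc]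
    exact e2
  have : D = 0 := LinearMap.ext key
  exact sub_eq_zero.1 this

theorem GInv.jac (h : GInv g T) (X Y Z : V) :
    T X (T Y Z) = T (T X Y) Z + T Y (T X Z) := h.inv _ (h.mem.1 X) Y Z

theorem GInv.uniq (h : GInv g T) (hc : Ctx g) (hirr : Irr g) {S : V →ₗ[ℝ] V →ₗ[ℝ] V}
    (hS : InP g S) : ∃ r : ℝ, S = r • T := by
  choose f hf using fun X => h.surj hc hirr (hS.1 X)
  have hinj : ∀ X Y, T X = T Y → X = Y := fun X Y e =>
    sub_eq_zero.1 (h.center hirr (by rw [map_sub, e, sub_self]))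
  let φ : V →ₗ[ℝ] V :=
    { toFun := f
      map_add' := fun a b => hinj _ _ (by rw [map_add, ← hf, ← hf, ← hf, map_add])
      map_smul' := fun r a => hinj _ _ (by
        rw [RingHom.id_apply, map_smul, ← hf, ← hf, map_smul]) }
  have hφ : ∀ X, S X = T (φ X) := hf
  have a1 : ∀ X Y, T (φ X) Y = T X (φ Y) := by
    intro X Y
    rw [← hφ, hS.anti, hφ, h.mem.anti, neg_neg]
  let ψ := LinearMap.adjoint φ
  have a2 : ∀ X u, T X (φ u) = ψ (T X u) := by
    intro X u
    refine ext_inner_right ℝ fun v => ?_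
    rw [LinearMap.adjoint_inner_left, ← a1, h.mem.sk hc, a1, h.mem.sk hc X u, ]
  let ω := φ - ψ
  have F1 : ∀ X Y u, T X (ω (T Y u)) = T Y (ω (T X u)) := by
    intro X Y u
    have e1 := h.jac X Y (φ u)
    rw [a2 Y, a2 X, a2 (T X Y), eq_sub_of_add_eq (h.jac X Y u).symm, map_sub, ← a2 X, ← a2 Y (T X u)] at e1
    simp only [ω, LinearMap.sub_apply, map_sub]
    rw [sub_eq_sub_iff_add_eq_add]
    have := congrArg (fun w => w + T Y (φ (T X u))) e1
    rw [add_comm (T Y (φ (T X u))), this]; abel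
  have F2 : ∀ X Y u, T X (ω (T Y u)) = - T X (ω (T u Y)) := by
    intro X Y u
    rw [h.mem.anti Y u, map_neg, map_neg]
  have F0 : ∀ X Y u, T X (ω (T Y u)) = 0 := by
    intro X Y u
    have : T X (ω (T Y u)) = - T X (ω (T Y u)) := by
      conv_lhs => rw [F1, F2, F1, F2, neg_neg, F1, F2]
    exact vec_self_neg this
  have F3 : ∀ Y u, ω (T Y u) = 0 := fun Y u => h.center' hirr fun X => F0 X Y u
  have ωs : ∀ u v, ⟪ω u, v⟫ = - ⟪u, ω v⟫ := by
    intro u v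
    simp only [ω, LinearMap.sub_apply, inner_sub_left, inner_sub_right, ψ,
      LinearMap.adjoint_inner_left, LinearMap.adjoint_inner_right]
    ring
  have ω0 : ∀ w, ω w = 0 := by
    intro w
    refine h.center' hirr fun Y => ?_
    refine inner_self_eq_zero (𝕜 := ℝ).1 ?_
    rw [h.mem.sk hc, ωs, F3, inner_zero_right]; simp
  have hsym : φ.IsSymmetric := by
    intro u v
    have := ω0 u
    simp only [ω, LinearMap.sub_apply] at this
    rw [sub_eq_zero.1 this]
    exact LinearMap.adjoint_inner_left _ _ _
  have hcomm : ∀ X u, T X (φ u) = φ (T X u) := by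
    intro X u
    have := ω0 (T X u)
    simp only [ω, LinearMap.sub_apply] at this
    rw [a2, sub_eq_zero.1 this]
  have hnt : Nontrivial V := by
    by_contra hn
    rw [not_nontrivial_iff_subsingleton] at hn
    exact h.ne (by ext u v; exact Subsingleton.elim _ _)
  have hev := hsym.hasEigenvalue_iSup_of_finiteDimensional
  set μ : ℝ := _ with hμ
  rcases hirr (Module.End.eigenspace φ μ) (fun A hA u hu => by
    obtain ⟨X, rfl⟩ := h.surj hc hirr hA
    rw [Module.End.mem_eigenspace_iff] at hu ⊢
    rw [← hcomm, hu, map_smul]) with h1 | h1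
  · exact absurd h1 hev
  · refine ⟨μ, ?_⟩
    ext u v
    have : u ∈ Module.End.eigenspace φ μ := by rw [h1]; trivial
    rw [Module.End.mem_eigenspace_iff] at this
    rw [hφ, this]; simp

end Step6

theorem alt_ext3 {T T' : AlternatingMap ℝ V ℝ (Fin 3)}
    (h : ∀ X Y Z, T ![X, Y, Z] = T' ![X, Y, Z]) : T = T' := by
  ext v
  have : v = ![v 0, v 1, v 2] := by
    funext i; fin_cases i <;> rfl
  rw [this]; exact h _ _ _

theorem from_alt {g : Submodule ℝ (V →ₗ[ℝ] V)} {T : AlternatingMap ℝ V ℝ (Fin 3)}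
    (h : InProlong g T) : ∃ τ, InP g τ ∧ ∀ X Y Z, ⟪τ X Y, Z⟫ = T ![X, Y, Z] := by
  choose A hA1 hA2 using h
  refine ⟨{ toFun := A, map_add' := ?_, map_smul' := ?_ }, ⟨hA1, ?_⟩, hA2⟩
  · intro X X'
    ext Y
    refine ext_inner_right ℝ fun Z => ?_
    rw [LinearMap.add_apply, inner_add_left, hA2, hA2, hA2]
    exact T.toMultilinearMap.cons_add ![Y, Z] X X'
  · intro r X
    ext Y
    refine ext_inner_right ℝ fun Z => ?_
    rw [LinearMap.smul_apply, real_inner_smul_left, RingHom.id_apply, hA2, hA2]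
    exact T.toMultilinearMap.cons_smul ![Y, Z] r X
  · intro X
    refine ext_inner_right ℝ fun Z => ?_
    rw [inner_zero_left]
    refine (hA2 X X Z).trans ?_
    exact T.map_eq_zero_of_eq _ (i := 0) (j := 1) rfl (by decide)

theorem fin3 : ∀ i : Fin 3, i = 0 ∨ i = 1 ∨ i = 2 := by decide
theorem n01 : (0 : Fin 3) ≠ 1 := by decide
theorem n02 : (0 : Fin 3) ≠ 2 := by decide
theorem n10 : (1 : Fin 3) ≠ 0 := by decide
theorem n12 : (1 : Fin 3) ≠ 2 := by decide
theorem n20 : (2 : Fin 3) ≠ 0 := by decide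
theorem n21 : (2 : Fin 3) ≠ 1 := by decide

/-- The three-form of a bracket. -/
def toAlt (br : V →ₗ[ℝ] V →ₗ[ℝ] V) (h1 : ∀ X Y, br X Y = - br Y X)
    (h2 : ∀ X Y Z : V, ⟪br X Y, Z⟫ = - ⟪Y, br X Z⟫) : AlternatingMap ℝ V ℝ (Fin 3) where
  toFun v := ⟪br (v 0) (v 1), v 2⟫
  map_update_add' := by
    intro inst v i a b
    rcases fin3 i with rfl | rfl | rfl <;> simp only [Function.update_self,
      Function.update_of_ne n01, Function.update_of_ne n02, Function.update_of_ne n10,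
      Function.update_of_ne n12, Function.update_of_ne n20, Function.update_of_ne n21, map_add,
      map_smul, LinearMap.add_apply, LinearMap.smul_apply, smul_eq_mul, inner_add_left, inner_add_right]
  map_update_smul' := by
    intro inst v i r a
    rcases fin3 i with rfl | rfl | rfl <;> simp only [Function.update_self,
      Function.update_of_ne n01, Function.update_of_ne n02, Function.update_of_ne n10,
      Function.update_of_ne n12, Function.update_of_ne n20, Function.update_of_ne n21, map_add,
      map_smul, LinearMap.add_apply, LinearMap.smul_apply, smul_eq_mul, real_inner_smul_left, real_inner_smul_right]
  map_eq_zero_of_eq' := by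
    have s0 : ∀ X, br X X = 0 := fun X => vec_self_neg (h1 X X)
    have s1 : ∀ X Y : V, ⟪br X Y, Y⟫ = 0 := fun X Y => by
      have := h2 X Y Y
      rw [real_inner_comm Y] at this
      linarith [real_inner_comm Y (br X Y)]
    have s2 : ∀ X Y : V, ⟪br X Y, X⟫ = 0 := fun X Y => by
      rw [h1, inner_neg_left, s1, neg_zero]
    intro v i j hij hne
    clear h1 h2
    fin_cases i <;> fin_cases j <;> first
      | exact absurd rfl hne
      | (simp only [Fin.zero_eta, Fin.mk_one, Fin.reduceFinMk] at hij
         simp only [hij, s0, s1, s2, inner_zero_left])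

theorem stmt_0
    (g : Submodule ℝ (V →ₗ[ℝ] V))
    (hgskew : ∀ A ∈ g, IsSkew A)
    (hglie : ∀ A ∈ g, ∀ B ∈ g, A ∘ₗ B - B ∘ₗ A ∈ g)
    (hproper : ∃ A : V →ₗ[ℝ] V, IsSkew A ∧ A ∉ g)
    (hirr : ∀ W : Submodule ℝ V, (∀ A ∈ g, ∀ x ∈ W, A x ∈ W) → W = ⊥ ∨ W = ⊤) :
    Xor'
      -- (i) the skew-symmetric prolongation vanishes
      (∀ T : AlternatingMap ℝ V ℝ (Fin 3), InProlong g T → T = 0)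
      -- (ii) `(g,V)` is the adjoint representation of a compact simple Lie algebra
      -- and the prolongation is one-dimensional, spanned by the Cartan 3-form
      (∃ br : V →ₗ[ℝ] V →ₗ[ℝ] V,
        -- a Lie bracket on `V` ...
        (∀ X Y : V, br X Y = - br Y X) ∧
        (∀ X Y Z : V, br (br X Y) Z + br (br Y Z) X + br (br Z X) Y = 0) ∧
        -- ... making `V` a simple Lie algebra ...
        (∃ X Y : V, br X Y ≠ 0) ∧
        (∀ I : Submodule ℝ V, (∀ X : V, ∀ y ∈ I, br X y ∈ I) → I = ⊥ ∨ I = ⊤) ∧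
        -- ... with negative-definite Killing form ...
        (∀ X : V, X ≠ 0 → LinearMap.trace ℝ V (br X ∘ₗ br X) < 0) ∧
        -- ... the inner product is ad-invariant ...
        (∀ X Y Z : V, ⟪br X Y, Z⟫ = - ⟪Y, br X Z⟫) ∧
        -- ... `g = {ad_X : X ∈ V}` ...
        (∀ A : V →ₗ[ℝ] V, A ∈ g ↔ ∃ X : V, A = br X) ∧
        -- ... the Cartan 3-form is nonzero and spans the prolongation
        (∃ X Y Z : V, ⟪br X Y, Z⟫ ≠ 0) ∧
        (∀ T : AlternatingMap ℝ V ℝ (Fin 3),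
          InProlong g T ↔ ∃ c : ℝ, ∀ X Y Z : V, T ![X, Y, Z] = c * ⟪br X Y, Z⟫)) := by
  have hc : Ctx g := ⟨hgskew, hglie⟩
  have hI : Irr g := hirr
  have hnf : ¬ FullSo g := by
    obtain ⟨A, hA, hA'⟩ := hproper
    exact fun h => hA' (h A hA)
  by_cases hi : ∀ T : AlternatingMap ℝ V ℝ (Fin 3), InProlong g T → T = 0
  · refine Or.inl ⟨hi, ?_⟩
    rintro ⟨br, h1, -, -, -, -, h2, h3, ⟨X, Y, Z, hne⟩, -⟩
    have h0 := hi (toAlt br h1 h2) (fun X => ⟨br X, (h3 _).2 ⟨X, rfl⟩, fun Y Z => rfl⟩)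
    apply hne
    have : toAlt br h1 h2 ![X, Y, Z] = 0 := by rw [h0]; rfl
    exact this
  · refine Or.inr ⟨?_, hi⟩
    push Not at hi
    obtain ⟨T₀, hT₀, hne₀⟩ := hi
    obtain ⟨τ, hτ, hτT⟩ := from_alt hT₀
    have hτ0 : τ ≠ 0 := by
      intro h0
      apply hne₀
      refine alt_ext3 fun X Y Z => ?_
      rw [← hτT, h0]
      exact inner_zero_left _
    obtain ⟨c, T, x, y, z, hb, m⟩ := exists_MT hc hτ hτ0
    have hT : GInv g T := by
      refine ⟨m.mem, ?_, ?_⟩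
      · intro h0
        have := m.val
        rw [h0] at this
        simp at this
      · intro A hA u v
        have h1 := m.invariant hb hc hI hnf hA
        have h2 : act A T u v = 0 := by rw [h1]; rfl
        rw [act_apply, sub_sub, sub_eq_zero] at h2
        exact h2
    have hxyz : ⟪T x y, z⟫ ≠ 0 := by rw [m.val]; exact one_ne_zero
    refine ⟨T, hT.mem.anti, ?_, ⟨x, y, ?_⟩, ?_, ?_, hT.mem.sk hc, ?_, ⟨x, y, z, hxyz⟩, ?_⟩
    · intro X Y Z
      have := hT.jac X Y Z
      rw [hT.mem.anti (T Y Z) X, hT.mem.anti (T Z X) Y, hT.mem.anti Z X, map_neg, neg_neg, this]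
      abel
    · intro h0
      apply hxyz
      rw [h0, inner_zero_left]
    · intro I hI'
      refine hirr I fun A hA u hu => ?_
      obtain ⟨X, rfl⟩ := hT.surj hc hI hA
      exact hI' X u hu
    · intro X hX
      refine lt_of_le_of_ne (skew_trace_nonpos (hc.skew _ (hT.mem.1 X))) fun h0 => hX ?_
      exact hT.center hI (skew_trace_zero (hc.skew _ (hT.mem.1 X)) h0)
    · intro A
      constructor
      · exact fun hA => hT.surj hc hI hA
      · rintro ⟨X, rfl⟩
        exact hT.mem.1 X
    · intro S
      constructor
      · intro hS
        obtain ⟨σ, hσ, hσS⟩ := from_alt hS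
        obtain ⟨r, rfl⟩ := hT.uniq hc hI hσ
        refine ⟨r, fun X Y Z => ?_⟩
        rw [← hσS, LinearMap.smul_apply, LinearMap.smul_apply, real_inner_smul_left]
      · rintro ⟨r, hr⟩ X
        refine ⟨r • T X, g.smul_mem _ (hT.mem.1 X), fun Y Z => ?_⟩
        rw [hr, LinearMap.smul_apply, real_inner_smul_left]
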